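/- Fix an integer a ≥ 1. For every irrational x ∈ (0,1) and every j ≥ 0 with a_{j+1} ≥ a, set m_j := ((a_{j+1} − a) p_j + p_{j−1})/((a_{j+1} − a) q_j + q_{j−1}); then 0 < Θ(x, m_j) < a + 1, except in the degenerate case j = 0 with a_1 = a (where m_0 = p_{−1}/q_{−1} = 1/0 and Θ = 0). Moreover, for Lebesgue-almost every irrational x ∈ (0,1) the set {j ≥ 0 : a_{j+1} ≥ a} is infinite and, enumerating it increasingly as j_0 < j_1 < ⋯ and setting C := log((a+1)/a), for every z ∈ [0, a+1] the limit lim_{n→∞} (1/n) · #{0 ≤ k < n : Θ(x, m_{j_k}) ≤ z} exists and equals: (1/C)·(z/(a(a+1))) for 0 ≤ z ≤ a; (1/C)·(1 − z/(a+1) + log(z/a)) for a ≤ z ≤ a+1. -/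

import Mathlib

open MeasureTheory Filter Topology
open scoped Classical

noncomputable section

/-- The Farey tent map `F`. -/
def fareyMap (x : ℝ) : ℝ := if x ≤ 1/2 then x / (1 - x) else (1 - x) / x

/-- `eps x n = ε_{n+1}(x)`, i.e. `0` if `F^[n] x ≤ 1/2` and `1` otherwise. -/
def eps (x : ℝ) (n : ℕ) : ℤ := if fareyMap^[n] x ≤ 1/2 then 0 else 1

/-- The matrices `A_0 = [[1,0],[1,1]]` and `A_1 = [[0,1],[1,1]]`. -/
def Amat (e : ℤ) : Matrix (Fin 2) (Fin 2) ℤ := !![1 - e, e; 1, 1]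

/-- `Mmat x n = A_{ε_1(x)} ⋯ A_{ε_n(x)}`, with `Mmat x 0` the identity. -/
def Mmat (x : ℝ) : ℕ → Matrix (Fin 2) (Fin 2) ℤ
  | 0 => 1
  | n + 1 => Mmat x n * Amat (eps x n)

/-- `u_n(x)`: top-left entry of `M_n(x)`. -/
def uF (x : ℝ) (n : ℕ) : ℤ := Mmat x n 0 0

/-- `s_n(x)`: bottom-left entry of `M_n(x)`. -/
def sF (x : ℝ) (n : ℕ) : ℤ := Mmat x n 1 0

/-- Ito's natural extension `F̄` of the Farey tent map. -/
def fareyNE (p : ℝ × ℝ) : ℝ × ℝ :=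
  if p.1 ≤ 1/2 then (p.1 / (1 - p.1), p.2 / (1 + p.2))
  else ((1 - p.1) / p.1, 1 / (1 + p.2))

/-- `Ω = [0,1]²`. -/
def OmegaSet : Set (ℝ × ℝ) := Set.Icc (0:ℝ) 1 ×ˢ Set.Icc (0:ℝ) 1

/-- The measure `μ̄` on `Ω` with density `(x + y − xy)⁻²` w.r.t. Lebesgue measure. -/
def muBar : Measure (ℝ × ℝ) :=
  (volume.restrict OmegaSet).withDensity
    (fun p => ENNReal.ofReal (1 / (p.1 + p.2 - p.1 * p.2) ^ 2))

/-- A proper inducible subregion of `Ω`. -/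
def ProperInducible (R : Set (ℝ × ℝ)) : Prop :=
  R ⊆ OmegaSet ∧ MeasurableSet R ∧ 0 < muBar R ∧ muBar R < ⊤ ∧ muBar (frontier R) = 0

/-- `hitsR R x k` holds iff `k ≥ 1` and `F̄^[k] (x,1) ∈ R`. -/
def hitsR (R : Set (ℝ × ℝ)) (x : ℝ) (k : ℕ) : Prop := 1 ≤ k ∧ fareyNE^[k] (x, 1) ∈ R

/-- `Nidx R x n = N_n`: `N_0 = 0` and, for `n ≥ 1`, the `n`-th smallest `k ≥ 1`
with `F̄^[k] (x,1) ∈ R`. -/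
def Nidx (R : Set (ℝ × ℝ)) (x : ℝ) : ℕ → ℕ
  | 0 => 0
  | n + 1 => Nat.nth (hitsR R x) n

/-- `h(x,y) = (1−y)/(x + y − xy)`. -/
def hIto (p : ℝ × ℝ) : ℝ := (1 - p.2) / (p.1 + p.2 - p.1 * p.2)

/-- `Θ_n(x) = s_n(x)·|s_n(x)·x − u_n(x)|`, the approximation coefficient of the
`n`-th Farey convergent `u_n(x)/s_n(x)`. -/
def ThetaF (x : ℝ) (n : ℕ) : ℝ := (sF x n : ℝ) * |(sF x n : ℝ) * x - (uF x n : ℝ)|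

/-- `Θ_n^R(x) = s_n^R·|s_n^R·x − u_n^R|` where `u_n^R = u_{N_n}(x)`, `s_n^R = s_{N_n}(x)`. -/
def ThetaR (R : Set (ℝ × ℝ)) (x : ℝ) (n : ℕ) : ℝ := ThetaF x (Nidx R x n)

/-- The Gauss map. -/
def gaussMap (x : ℝ) : ℝ := Int.fract (1 / x)

/-- `pquot x n` is the RCF partial quotient `a_{n+1}(x)`. -/
def pquot (x : ℝ) (n : ℕ) : ℤ := ⌊1 / (gaussMap^[n] x)⌋

/-- `pnum x (j+1)` is the RCF numerator `p_j(x)`; `pnum x 0 = p_{-1} = 1`. -/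
def pnum (x : ℝ) : ℕ → ℤ
  | 0 => 1
  | 1 => 0
  | n + 2 => pquot x n * pnum x (n + 1) + pnum x n

/-- `qden x (j+1)` is the RCF denominator `q_j(x)`; `qden x 0 = q_{-1} = 0`. -/
def qden (x : ℝ) : ℕ → ℤ
  | 0 => 0
  | 1 => 1
  | n + 2 => pquot x n * qden x (n + 1) + qden x n

/-- The approximation coefficient `Θ(x, p/q) = q·|q·x − p|`. -/
def Theta (x : ℝ) (p q : ℤ) : ℝ := (q : ℝ) * |(q : ℝ) * x - (p : ℝ)|

/-- `medTheta x l j = Θ(x, (l·p_j + p_{j−1})/(l·q_j + q_{j−1}))`. -/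
def medTheta (x : ℝ) (l : ℤ) (j : ℕ) : ℝ :=
  Theta x (l * pnum x (j + 1) + pnum x j) (l * qden x (j + 1) + qden x j)

end

/-- The limiting distribution function, with normalising constant `C = log((a+1)/a)`. -/
noncomputable def dist8 (a : ℕ) (z : ℝ) : ℝ :=
  (1 / Real.log (((a:ℝ) + 1) / (a:ℝ))) *
    (if z ≤ (a:ℝ) then z / ((a:ℝ) * ((a:ℝ) + 1))
     else 1 - z / ((a:ℝ) + 1) + Real.log (z / (a:ℝ)))

noncomputable section

/-- The `n`-th inverse branch `s ↦ 1 / (n + 1 + s)` of the Gauss map. -/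
def gaussBranch (n : ℕ) (s : ℝ) : ℝ := 1 / ((n : ℝ) + 1 + s)

/-- The density of the future `t` of a continued fraction expansion whose past is `V`. -/
def futureDensity (V t : ℝ) : ℝ := (1 + V) / (1 + t * V) ^ 2

/-- The mean of `H` with respect to the law of the future, given the past `V`. -/
def futureMean (V : ℝ) (H : ℝ → ℝ) : ℝ := ∫ t in Set.Ioo (0:ℝ) 1, futureDensity V t * H t

/-- The probability that the next partial quotient is `n + 1`, given the past `V`. -/
def digitProb (V : ℝ) (n : ℕ) : ℝ := (1 + V) / (((n : ℝ) + 1 + V) * ((n : ℝ) + 2 + V))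

/-- The natural extension of the Gauss map. -/
def gaussNE (p : ℝ × ℝ) : ℝ × ℝ := (gaussMap p.1, 1 / ((⌊1 / p.1⌋ : ℝ) + p.2))

end

section Branches

variable {n : ℕ} {s V : ℝ}

lemma gaussBranch_mem_Ioo (hs : s ∈ Set.Ioo (0:ℝ) 1) : gaussBranch n s ∈ Set.Ioo (0:ℝ) 1 := by
  have hn : (0:ℝ) ≤ n := n.cast_nonneg
  obtain ⟨h0, h1⟩ := hs
  refine ⟨by unfold gaussBranch; positivity, ?_⟩
  rw [gaussBranch, div_lt_one (by positivity)]
  linarith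

lemma gaussBranch_mem_Icc (hs : s ∈ Set.Icc (0:ℝ) 1) : gaussBranch n s ∈ Set.Icc (0:ℝ) 1 := by
  have hn : (0:ℝ) ≤ n := n.cast_nonneg
  obtain ⟨h0, h1⟩ := hs
  refine ⟨by unfold gaussBranch; positivity, ?_⟩
  rw [gaussBranch, div_le_one (by positivity)]
  linarith

lemma floor_one_div_gaussBranch (hs : s ∈ Set.Ioo (0:ℝ) 1) :
    ⌊1 / gaussBranch n s⌋ = (n : ℤ) + 1 := by
  rw [gaussBranch, one_div_one_div, Int.floor_eq_iff]
  push_cast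
  constructor <;> linarith [hs.1, hs.2]

lemma gaussMap_gaussBranch (hs : s ∈ Set.Ioo (0:ℝ) 1) : gaussMap (gaussBranch n s) = s := by
  rw [gaussMap, Int.fract, floor_one_div_gaussBranch hs, gaussBranch, one_div_one_div]
  push_cast
  ring

lemma gaussNE_gaussBranch (hs : s ∈ Set.Ioo (0:ℝ) 1) :
    gaussNE (gaussBranch n s, V) = (s, gaussBranch n V) := by
  rw [gaussNE, gaussMap_gaussBranch hs, floor_one_div_gaussBranch hs, gaussBranch]
  push_cast
  rfl

lemma measurable_gaussBranch : Measurable (gaussBranch n) := by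
  unfold gaussBranch
  fun_prop

lemma measurable_gaussMap : Measurable gaussMap := by
  unfold gaussMap
  exact measurable_fract.comp (by fun_prop)

lemma measurable_gaussNE : Measurable gaussNE := by
  unfold gaussNE
  refine (measurable_gaussMap.comp measurable_fst).prodMk ?_
  have : Measurable fun p : ℝ × ℝ => ((⌊1 / p.1⌋ : ℤ) : ℝ) :=
    (measurable_from_top (f := fun n : ℤ => (n : ℝ))).comp
      (Int.measurable_floor.comp (by fun_prop))
  fun_prop

lemma image_gaussBranch (n : ℕ) : gaussBranch n '' Set.Ioo (0:ℝ) 1 =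
    Set.Ioo (1 / ((n:ℝ) + 2)) (1 / ((n:ℝ) + 1)) := by
  have hn : (0:ℝ) ≤ n := n.cast_nonneg
  ext t
  constructor
  · rintro ⟨s, ⟨h0, h1⟩, rfl⟩
    unfold gaussBranch
    exact ⟨one_div_lt_one_div_of_lt (by positivity) (by linarith),
      one_div_lt_one_div_of_lt (by positivity) (by linarith)⟩
  · rintro ⟨h0, h1⟩
    have ht : 0 < t := lt_trans (by positivity) h0
    rw [div_lt_iff₀ (by positivity)] at h0
    rw [lt_div_iff₀ (by positivity)] at h1
    have h2 : 1 / t < n + 2 := by rw [div_lt_iff₀ ht]; linarith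
    have h3 : (n:ℝ) + 1 < 1 / t := by rw [lt_div_iff₀ ht]; linarith
    refine ⟨1 / t - (n + 1), ⟨by linarith, by linarith⟩, ?_⟩
    rw [gaussBranch, add_sub_cancel, one_div_one_div]

lemma setIntegral_image_gaussBranch (n : ℕ) (h : ℝ → ℝ) :
    ∫ t in gaussBranch n '' Set.Ioo (0:ℝ) 1, h t =
      ∫ s in Set.Ioo (0:ℝ) 1, gaussBranch n s ^ 2 * h (gaussBranch n s) := by
  have hn : (0:ℝ) ≤ n := n.cast_nonneg
  rw [integral_image_eq_integral_abs_deriv_smul (f' := fun s => -(gaussBranch n s ^ 2))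
    measurableSet_Ioo]
  · simp [abs_neg, abs_of_nonneg, sq_nonneg]
  · intro s hs
    have hne : (n:ℝ) + 1 + s ≠ 0 := by have := hs.1; positivity
    have h1 : HasDerivAt (fun x => ((n:ℝ) + 1 + x)⁻¹) (-1 / ((n:ℝ) + 1 + s) ^ 2) s :=
      ((hasDerivAt_id s).const_add ((n:ℝ) + 1)).inv hne
    have h2 : gaussBranch n = fun x => ((n:ℝ) + 1 + x)⁻¹ := by
      funext x
      simp [gaussBranch]
    rw [h2]
    exact (h1.congr_deriv (by rw [inv_pow, neg_div, one_div])).hasDerivWithinAt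
  · intro s hs t ht hst
    have := congrArg gaussMap hst
    rwa [gaussMap_gaussBranch hs, gaussMap_gaussBranch ht] at this

lemma iUnion_Ioc_one_div :
    ⋃ n : ℕ, Set.Ioc (1 / ((n:ℝ) + 2)) (1 / ((n:ℝ) + 1)) = Set.Ioc (0:ℝ) 1 := by
  ext t
  simp only [Set.mem_iUnion, Set.mem_Ioc]
  constructor
  · rintro ⟨n, h0, h1⟩
    have hn : (0:ℝ) ≤ n := n.cast_nonneg
    refine ⟨lt_trans (by positivity) h0, h1.trans ?_⟩
    rw [div_le_one (by positivity)]
    linarith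
  · rintro ⟨h0, h1⟩
    have h2 : 1 ≤ 1 / t := by rwa [le_div_iff₀ h0, one_mul]
    have h3 : 1 ≤ ⌊1 / t⌋₊ := Nat.le_floor (by simpa using h2)
    obtain ⟨n, hn⟩ := Nat.exists_eq_add_of_le h3
    have h4 := Nat.floor_le (by positivity : 0 ≤ 1 / t)
    have h5 := Nat.lt_floor_add_one (1 / t)
    rw [hn] at h4 h5
    push_cast at h4 h5
    rw [le_div_iff₀ h0] at h4
    rw [div_lt_iff₀ h0] at h5
    refine ⟨n, ?_, ?_⟩
    · rw [div_lt_iff₀ (by positivity)]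
      linarith
    · rw [le_div_iff₀ (by positivity)]
      linarith

lemma pairwise_disjoint_Ioc_one_div : Pairwise (Function.onFun Disjoint fun n : ℕ =>
    Set.Ioc (1 / ((n:ℝ) + 2)) (1 / ((n:ℝ) + 1))) := by
  have key : ∀ m n : ℕ, m < n → Disjoint (Set.Ioc (1 / ((m:ℝ) + 2)) (1 / ((m:ℝ) + 1)))
      (Set.Ioc (1 / ((n:ℝ) + 2)) (1 / ((n:ℝ) + 1))) := by
    intro m n hmn
    have h : (m:ℝ) + 1 ≤ n := by exact_mod_cast hmn
    refine (Set.Ioc_disjoint_Ioc_of_le ?_).symm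
    exact one_div_le_one_div_of_le (by positivity) (by linarith)
  intro m n hmn
  rcases lt_or_gt_of_ne hmn with h | h
  · exact key m n h
  · exact (key n m h).symm

/-- Decomposition of an integral over `(0,1)` along the branches of the Gauss map. -/
lemma hasSum_setIntegral_gaussBranch {h : ℝ → ℝ} (hh : IntegrableOn h (Set.Ioo 0 1)) :
    HasSum (fun n : ℕ => ∫ s in Set.Ioo (0:ℝ) 1, gaussBranch n s ^ 2 * h (gaussBranch n s))
      (∫ t in Set.Ioo (0:ℝ) 1, h t) := by
  have h1 := hasSum_integral_iUnion (μ := volume) (f := h) (fun n : ℕ => measurableSet_Ioc)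
    pairwise_disjoint_Ioc_one_div (by
      rw [iUnion_Ioc_one_div]
      exact integrableOn_Ioc_iff_integrableOn_Ioo (by simp) |>.2 hh)
  rw [iUnion_Ioc_one_div, integral_Ioc_eq_integral_Ioo] at h1
  simpa only [← setIntegral_image_gaussBranch, image_gaussBranch, integral_Ioc_eq_integral_Ioo]
    using h1

end Branches

section FutureMean

variable {V W t : ℝ}

lemma futureDensity_pos (hV : V ∈ Set.Icc (0:ℝ) 1) (ht : t ∈ Set.Ioo (0:ℝ) 1) :
    0 < futureDensity V t := by
  have := hV.1
  have := ht.1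
  unfold futureDensity
  positivity

lemma futureDensity_le_two (hV : V ∈ Set.Icc (0:ℝ) 1) (ht : t ∈ Set.Ioo (0:ℝ) 1) :
    futureDensity V t ≤ 2 := by
  have h1 := hV.1
  have h2 := ht.1
  have h3 : 0 ≤ t * V := by positivity
  rw [futureDensity, div_le_iff₀ (by positivity)]
  nlinarith [hV.2]

lemma measurable_futureDensity : Measurable (futureDensity V) := by
  unfold futureDensity
  fun_prop

lemma integrableOn_of_bound {H : ℝ → ℝ} {B : ℝ} (hH : Measurable H)
    (hB : ∀ t ∈ Set.Ioo (0:ℝ) 1, |H t| ≤ B) : IntegrableOn H (Set.Ioo 0 1) :=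
  Measure.integrableOn_of_bounded (M := B) (by simp) hH.aestronglyMeasurable
    ((ae_restrict_iff' measurableSet_Ioo).2 (ae_of_all _ hB))

lemma integrableOn_futureDensity_mul {H : ℝ → ℝ} {B : ℝ} (hV : V ∈ Set.Icc (0:ℝ) 1)
    (hH : Measurable H) (hB : ∀ t ∈ Set.Ioo (0:ℝ) 1, |H t| ≤ B) :
    IntegrableOn (fun t => futureDensity V t * H t) (Set.Ioo 0 1) := by
  refine integrableOn_of_bound (B := 2 * B) (measurable_futureDensity.mul hH) fun t ht => ?_
  rw [abs_mul, abs_of_pos (futureDensity_pos hV ht)]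
  exact mul_le_mul (futureDensity_le_two hV ht) (hB t ht) (abs_nonneg _) (by norm_num)

lemma futureMean_const (hV : V ∈ Set.Icc (0:ℝ) 1) (c : ℝ) : futureMean V (fun _ => c) = c := by
  have h0 := hV.1
  have h1 : ∫ t in (0:ℝ)..1, futureDensity V t = 1 := by
    have hd : ∀ t ∈ Set.uIcc (0:ℝ) 1,
        HasDerivAt (fun t => t * (1 + V) / (1 + t * V)) (futureDensity V t) t := by
      intro t ht
      rw [Set.uIcc_of_le zero_le_one] at ht
      have ht0 := ht.1
      have hne : 1 + t * V ≠ 0 := by positivity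
      refine (((hasDerivAt_id t).mul_const (1 + V)).div
        (((hasDerivAt_id t).mul_const V).const_add 1) hne).congr_deriv ?_
      simp only [futureDensity, id]
      ring
    rw [intervalIntegral.integral_eq_sub_of_hasDerivAt hd]
    · have : 1 + V ≠ 0 := by positivity
      simp [this]
    · refine ContinuousOn.intervalIntegrable fun t ht => ContinuousAt.continuousWithinAt ?_
      rw [Set.uIcc_of_le zero_le_one] at ht
      have ht0 := ht.1
      have hne : (1 + t * V) ^ 2 ≠ 0 := by positivity
      unfold futureDensity
      fun_prop (disch := assumption)
  rw [futureMean, integral_mul_const, ← integral_Ioc_eq_integral_Ioo,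
    ← intervalIntegral.integral_of_le zero_le_one, h1, one_mul]

lemma futureMean_mono {H K : ℝ → ℝ} {B C : ℝ} (hV : V ∈ Set.Icc (0:ℝ) 1) (hH : Measurable H)
    (hK : Measurable K) (hB : ∀ t ∈ Set.Ioo (0:ℝ) 1, |H t| ≤ B)
    (hC : ∀ t ∈ Set.Ioo (0:ℝ) 1, |K t| ≤ C) (h : ∀ t ∈ Set.Ioo (0:ℝ) 1, H t ≤ K t) :
    futureMean V H ≤ futureMean V K :=
  setIntegral_mono_on (integrableOn_futureDensity_mul hV hH hB)
    (integrableOn_futureDensity_mul hV hK hC) measurableSet_Ioo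
    fun t ht => mul_le_mul_of_nonneg_left (h t ht) (futureDensity_pos hV ht).le

lemma futureMean_add {H K : ℝ → ℝ} {B C : ℝ} (hV : V ∈ Set.Icc (0:ℝ) 1) (hH : Measurable H)
    (hK : Measurable K) (hB : ∀ t ∈ Set.Ioo (0:ℝ) 1, |H t| ≤ B)
    (hC : ∀ t ∈ Set.Ioo (0:ℝ) 1, |K t| ≤ C) :
    futureMean V (fun t => H t + K t) = futureMean V H + futureMean V K := by
  rw [futureMean, futureMean, futureMean, ← integral_add (integrableOn_futureDensity_mul hV hH hB)
    (integrableOn_futureDensity_mul hV hK hC)]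
  simp only [mul_add]

lemma futureMean_const_mul (c : ℝ) (H : ℝ → ℝ) :
    futureMean V (fun t => c * H t) = c * futureMean V H := by
  rw [futureMean, futureMean, ← integral_const_mul]
  congr 1
  funext t
  ring

lemma futureMean_congr {H K : ℝ → ℝ} (h : ∀ t ∈ Set.Ioo (0:ℝ) 1, H t = K t) :
    futureMean V H = futureMean V K :=
  setIntegral_congr_fun measurableSet_Ioo fun t ht => by simp only [h t ht]

lemma abs_futureMean_le {H : ℝ → ℝ} {B : ℝ} (hV : V ∈ Set.Icc (0:ℝ) 1) (hH : Measurable H)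
    (hB : ∀ t ∈ Set.Ioo (0:ℝ) 1, |H t| ≤ B) : |futureMean V H| ≤ B := by
  rw [abs_le]
  have h1 : ∀ c : ℝ, ∀ t ∈ Set.Ioo (0:ℝ) 1, |(fun _ : ℝ => c) t| ≤ |c| := fun c t _ => le_rfl
  constructor
  · rw [← futureMean_const hV (-B)]
    exact futureMean_mono hV measurable_const hH (h1 _) hB fun t ht => (abs_le.1 (hB t ht)).1
  · rw [← futureMean_const hV B]
    exact futureMean_mono hV hH measurable_const hB (h1 _) fun t ht => (abs_le.1 (hB t ht)).2

lemma digitProb_nonneg (hV : V ∈ Set.Icc (0:ℝ) 1) (n : ℕ) : 0 ≤ digitProb V n := by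
  have := hV.1
  unfold digitProb
  positivity

lemma gaussBranch_sq_mul_futureDensity (hV : V ∈ Set.Icc (0:ℝ) 1) (n : ℕ)
    (ht : t ∈ Set.Ioo (0:ℝ) 1) : gaussBranch n t ^ 2 * futureDensity V (gaussBranch n t) =
      digitProb V n * futureDensity (gaussBranch n V) t := by
  have h0 := hV.1
  have h1 := ht.1
  have hn : (0:ℝ) ≤ n := n.cast_nonneg
  unfold futureDensity digitProb gaussBranch
  have h2 : (n:ℝ) + 1 + t ≠ 0 := by positivity
  have h3 : (n:ℝ) + 1 + V ≠ 0 := by positivity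
  have h4 : (n:ℝ) + 2 + V ≠ 0 := by positivity
  have h5 : (n:ℝ) + 1 + t + V ≠ 0 := by positivity
  have h6 : 1 + 1 / ((n:ℝ) + 1 + t) * V = (n + 1 + t + V) / (n + 1 + t) := by field_simp
  have h7 : 1 + t * (1 / ((n:ℝ) + 1 + V)) = (n + 1 + t + V) / (n + 1 + V) := by
    field_simp; ring
  rw [h6, h7]
  field_simp
  ring

/-- Conditioning the future on its first digit. -/
lemma hasSum_futureMean {H : ℝ → ℝ} {B : ℝ} (hV : V ∈ Set.Icc (0:ℝ) 1) (hH : Measurable H)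
    (hB : ∀ t ∈ Set.Ioo (0:ℝ) 1, |H t| ≤ B) :
    HasSum (fun n : ℕ => digitProb V n *
      futureMean (gaussBranch n V) (fun s => H (gaussBranch n s))) (futureMean V H) := by
  have h1 := hasSum_setIntegral_gaussBranch (integrableOn_futureDensity_mul hV hH hB)
  have h2 : ∀ n : ℕ, digitProb V n *
      futureMean (gaussBranch n V) (fun s => H (gaussBranch n s)) =
      ∫ s in Set.Ioo (0:ℝ) 1, gaussBranch n s ^ 2 *
        (futureDensity V (gaussBranch n s) * H (gaussBranch n s)) := by
    intro n
    rw [futureMean, ← integral_const_mul]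
    refine setIntegral_congr_fun measurableSet_Ioo fun t ht => ?_
    rw [← mul_assoc, ← mul_assoc, gaussBranch_sq_mul_futureDensity hV n ht]
  simp only [h2]
  exact h1

lemma hasSum_digitProb (hV : V ∈ Set.Icc (0:ℝ) 1) : HasSum (digitProb V) 1 := by
  have := hasSum_futureMean (H := fun _ => 1) (B := 1) hV measurable_const (by simp)
  simp only [futureMean_const hV, fun n : ℕ => futureMean_const (gaussBranch_mem_Icc (n := n) hV),
    mul_one] at this
  exact this

end FutureMean

section Transfer

variable {V W L : ℝ} {g U : ℝ → ℝ}

lemma HasSum.abs_le_of_digitProb {y : ℕ → ℝ} {Y C : ℝ} (hV : V ∈ Set.Icc (0:ℝ) 1)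
    (hY : HasSum (fun n => digitProb V n * y n) Y) (hy : ∀ n, |y n| ≤ C) : |Y| ≤ C := by
  have h := tsum_of_norm_bounded ((hasSum_digitProb hV).mul_right C)
    (f := fun n => digitProb V n * y n) fun n => by
      rw [Real.norm_eq_abs, abs_mul, abs_of_nonneg (digitProb_nonneg hV n)]
      exact mul_le_mul_of_nonneg_left (hy n) (digitProb_nonneg hV n)
  rwa [hY.tsum_eq, one_mul, Real.norm_eq_abs] at h

lemma gaussBranch_sub (hV : V ∈ Set.Icc (0:ℝ) 1) (hW : W ∈ Set.Icc (0:ℝ) 1) (n : ℕ) :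
    gaussBranch n V - gaussBranch n W = (W - V) / (((n:ℝ) + 1 + V) * ((n:ℝ) + 1 + W)) := by
  have h0 := hV.1
  have h1 := hW.1
  have hn : (0:ℝ) ≤ n := n.cast_nonneg
  have h2 : (n:ℝ) + 1 + V ≠ 0 := by positivity
  have h3 : (n:ℝ) + 1 + W ≠ 0 := by positivity
  unfold gaussBranch
  field_simp
  ring

lemma abs_le_of_lipschitz (hg : ∀ V ∈ Set.Icc (0:ℝ) 1, ∀ W ∈ Set.Icc (0:ℝ) 1,
    |g V - g W| ≤ L * |V - W|) (hV : V ∈ Set.Icc (0:ℝ) 1) : |g V| ≤ |g 0| + L := by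
  have hL : 0 ≤ L := by
    have := (abs_nonneg _).trans (hg 0 (by simp) 1 (by simp))
    simpa using this
  have h1 := hg V hV 0 (by simp)
  rw [sub_zero, abs_of_nonneg hV.1] at h1
  have h2 : L * V ≤ L := mul_le_of_le_one_right hL hV.2
  have h3 := abs_add_le (g V - g 0) (g 0)
  rw [sub_add_cancel] at h3
  linarith

lemma sum_sub_mul_eq (D h : ℕ → ℝ) (N : ℕ) :
    ∑ n ∈ Finset.range N, (D n - D (n + 1)) * h n = D 0 * h 0 - D N * h N +
      ∑ n ∈ Finset.range N, D (n + 1) * (h (n + 1) - h n) := by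
  induction N with
  | zero => simp
  | succ N ih =>
    rw [Finset.sum_range_succ, ih, Finset.sum_range_succ]
    ring

/-- Changing the past only in the branches contracts. -/
lemma abs_tsum_digitProb_sub_le (hV : V ∈ Set.Icc (0:ℝ) 1) (hW : W ∈ Set.Icc (0:ℝ) 1)
    (hL : 0 ≤ L)
    (hg : ∀ V ∈ Set.Icc (0:ℝ) 1, ∀ W ∈ Set.Icc (0:ℝ) 1, |g V - g W| ≤ L * |V - W|) :
    |∑' n, digitProb V n * (g (gaussBranch n V) - g (gaussBranch n W))| ≤
      5 / 8 * L * |V - W| := by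
  have hV0 := hV.1
  have hW0 := hW.1
  have hsum : HasSum (fun n : ℕ => L * |V - W| *
      (digitProb V n * (1 / 4) + if n = 0 then 3 / 8 else 0)) (L * |V - W| * (1 * (1 / 4) + 3 / 8)) :=
    (((hasSum_digitProb hV).mul_right _).add (hasSum_ite_eq 0 (3 / 8 : ℝ))).mul_left _
  have h := tsum_of_norm_bounded hsum
    (f := fun n => digitProb V n * (g (gaussBranch n V) - g (gaussBranch n W))) fun n => by
      have hn : (0:ℝ) ≤ n := n.cast_nonneg
      have hP := digitProb_nonneg hV n
      have h1 := hg _ (gaussBranch_mem_Icc (n := n) hV) _ (gaussBranch_mem_Icc (n := n) hW)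
      rw [gaussBranch_sub hV hW, abs_div, abs_sub_comm W V,
        abs_of_pos (by positivity : 0 < ((n:ℝ) + 1 + V) * ((n:ℝ) + 1 + W))] at h1
      have h2 : digitProb V n * (1 / (((n:ℝ) + 1 + V) * ((n:ℝ) + 1 + W))) ≤
          digitProb V n * (1 / 4) + if n = 0 then 3 / 8 else 0 := by
        split_ifs with h0
        · subst h0
          have h3 : digitProb V 0 ≤ 1 / 2 := by
            unfold digitProb
            push_cast
            rw [div_le_iff₀ (by positivity)]
            nlinarith
          have h4 : 1 / ((((0:ℕ):ℝ) + 1 + V) * (((0:ℕ):ℝ) + 1 + W)) ≤ 1 := by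
            push_cast
            rw [div_le_one (by positivity)]
            nlinarith [mul_nonneg hV0 hW0]
          nlinarith
        · have h3 : (1:ℝ) ≤ n := by exact_mod_cast Nat.one_le_iff_ne_zero.2 h0
          rw [add_zero]
          refine mul_le_mul_of_nonneg_left ?_ hP
          exact one_div_le_one_div_of_le (by norm_num) (by nlinarith)
      rw [Real.norm_eq_abs, abs_mul, abs_of_nonneg hP]
      calc digitProb V n * |g (gaussBranch n V) - g (gaussBranch n W)|
          ≤ digitProb V n * (L * (|V - W| / (((n:ℝ) + 1 + V) * ((n:ℝ) + 1 + W)))) :=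
            mul_le_mul_of_nonneg_left h1 hP
        _ = L * |V - W| * (digitProb V n * (1 / (((n:ℝ) + 1 + V) * ((n:ℝ) + 1 + W)))) := by ring
        _ ≤ _ := mul_le_mul_of_nonneg_left h2 (by positivity)
  rw [Real.norm_eq_abs] at h
  linarith

lemma abs_sum_digitProb_sub_le (hV : V ∈ Set.Icc (0:ℝ) 1) (hW : W ∈ Set.Icc (0:ℝ) 1)
    (hg : ∀ V ∈ Set.Icc (0:ℝ) 1, ∀ W ∈ Set.Icc (0:ℝ) 1, |g V - g W| ≤ L * |V - W|) (N : ℕ) :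
    |∑ n ∈ Finset.range N, (digitProb V n - digitProb W n) * g (gaussBranch n W)| ≤
      1 / 4 * L * |V - W| + |V - W| * (|g 0| + L) * (1 / ((N:ℝ) + 1)) := by
  have hV0 := hV.1
  have hW0 := hW.1
  have hL : 0 ≤ L := by
    have := (abs_nonneg _).trans (hg 0 (by simp) 1 (by simp))
    simpa using this
  set D : ℕ → ℝ := fun n => (1 + V) / ((n:ℝ) + 1 + V) - (1 + W) / ((n:ℝ) + 1 + W) with hD
  have hDn : ∀ n : ℕ, D n = (V - W) * n / (((n:ℝ) + 1 + V) * ((n:ℝ) + 1 + W)) := by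
    intro n
    have h2 : (n:ℝ) + 1 + V ≠ 0 := by positivity
    have h3 : (n:ℝ) + 1 + W ≠ 0 := by positivity
    simp only [hD]
    field_simp
    ring
  have hPD : ∀ n : ℕ, digitProb V n - digitProb W n = D n - D (n + 1) := by
    intro n
    have key : ∀ X : ℝ, 0 ≤ X → digitProb X n =
        (1 + X) / ((n:ℝ) + 1 + X) - (1 + X) / (((n + 1 : ℕ):ℝ) + 1 + X) := by
      intro X hX
      have h2 : (n:ℝ) + 1 + X ≠ 0 := by positivity
      have h3 : (n:ℝ) + 2 + X ≠ 0 := by positivity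
      have h4 : ((n + 1 : ℕ):ℝ) + 1 + X = (n:ℝ) + 2 + X := by push_cast; ring
      rw [h4, digitProb]
      field_simp
      ring
    rw [key V hV0, key W hW0]
    simp only [hD]
    ring
  have hDabs : ∀ n : ℕ, |D n| = |V - W| * n / (((n:ℝ) + 1 + V) * ((n:ℝ) + 1 + W)) := by
    intro n
    rw [hDn, abs_div, abs_mul, abs_of_nonneg (n.cast_nonneg : (0:ℝ) ≤ n),
      abs_of_pos (by positivity : 0 < ((n:ℝ) + 1 + V) * ((n:ℝ) + 1 + W))]
  have hD0 : D 0 = 0 := by rw [hDn]; simp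
  simp only [hPD]
  rw [sum_sub_mul_eq D (fun n => g (gaussBranch n W)) N, hD0, zero_mul, zero_sub]
  have hlast : |D N * g (gaussBranch N W)| ≤ |V - W| * (|g 0| + L) * (1 / ((N:ℝ) + 1)) := by
    rw [abs_mul, hDabs]
    have h1 := abs_le_of_lipschitz hg (gaussBranch_mem_Icc (n := N) hW)
    have h2 : |V - W| * N / (((N:ℝ) + 1 + V) * ((N:ℝ) + 1 + W)) ≤
        |V - W| * (1 / ((N:ℝ) + 1)) := by
      rw [mul_div_assoc]
      refine mul_le_mul_of_nonneg_left ?_ (abs_nonneg _)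
      rw [div_le_div_iff₀ (by positivity) (by positivity)]
      have hN : (0:ℝ) ≤ N := N.cast_nonneg
      nlinarith [mul_nonneg hV0 hW0, mul_nonneg hN hV0, mul_nonneg hN hW0]
    calc _ ≤ |V - W| * (1 / ((N:ℝ) + 1)) * (|g 0| + L) :=
          mul_le_mul h2 h1 (abs_nonneg _) (by positivity)
      _ = _ := by ring
  have hsum : |∑ n ∈ Finset.range N, D (n + 1) *
      (g (gaussBranch (n + 1) W) - g (gaussBranch n W))| ≤
      L * |V - W| * (1 / 4 - 1 / (2 * ((N:ℝ) + 1) * ((N:ℝ) + 2))) := by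
    have hterm : ∀ n : ℕ, |D (n + 1) * (g (gaussBranch (n + 1) W) - g (gaussBranch n W))| ≤
        L * |V - W| * (1 / (2 * ((n:ℝ) + 1) * ((n:ℝ) + 2)) -
          1 / (2 * ((n:ℝ) + 2) * ((n:ℝ) + 3))) := by
      intro n
      have hn : (0:ℝ) ≤ n := n.cast_nonneg
      have h1 := hg _ (gaussBranch_mem_Icc (n := n + 1) hW) _ (gaussBranch_mem_Icc (n := n) hW)
      have h2 : gaussBranch (n + 1) W - gaussBranch n W =
          -(1 / (((n:ℝ) + 2 + W) * ((n:ℝ) + 1 + W))) := by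
        have h3 : (n:ℝ) + 1 + W ≠ 0 := by positivity
        have h4 : (n:ℝ) + 2 + W ≠ 0 := by positivity
        have h5 : ((n + 1 : ℕ):ℝ) + 1 + W = (n:ℝ) + 2 + W := by push_cast; ring
        rw [gaussBranch, gaussBranch, h5]
        field_simp
        ring
      rw [h2, abs_neg, abs_of_pos
        (by positivity : 0 < 1 / (((n:ℝ) + 2 + W) * ((n:ℝ) + 1 + W)))] at h1
      rw [abs_mul, hDabs]
      push_cast
      have h6 : (n:ℝ) + 1 + 1 + V = n + 2 + V := by ring
      have h7 : (n:ℝ) + 1 + 1 + W = n + 2 + W := by ring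
      rw [h6, h7]
      have h8 : |V - W| * ((n:ℝ) + 1) / (((n:ℝ) + 2 + V) * ((n:ℝ) + 2 + W)) ≤
          |V - W| * (((n:ℝ) + 1) / (((n:ℝ) + 2) * ((n:ℝ) + 2))) := by
        rw [mul_div_assoc]
        refine mul_le_mul_of_nonneg_left ?_ (abs_nonneg _)
        refine div_le_div_of_nonneg_left (by positivity) (by positivity) ?_
        exact mul_le_mul (by linarith) (by linarith) (by positivity) (by positivity)
      have h9 : 1 / (((n:ℝ) + 2 + W) * ((n:ℝ) + 1 + W)) ≤ 1 / (((n:ℝ) + 2) * ((n:ℝ) + 1)) := by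
        refine one_div_le_one_div_of_le (by positivity) ?_
        exact mul_le_mul (by linarith) (by linarith) (by positivity) (by positivity)
      calc _ ≤ |V - W| * (((n:ℝ) + 1) / (((n:ℝ) + 2) * ((n:ℝ) + 2))) *
            (L * (1 / (((n:ℝ) + 2) * ((n:ℝ) + 1)))) :=
            mul_le_mul h8 (h1.trans (mul_le_mul_of_nonneg_left h9 hL)) (abs_nonneg _)
              (by positivity)
        _ = L * |V - W| * (1 / ((n:ℝ) + 2) ^ 3) := by
            field_simp
        _ ≤ _ := by
            refine mul_le_mul_of_nonneg_left ?_ (by positivity)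
            have : 1 / (2 * ((n:ℝ) + 1) * ((n:ℝ) + 2)) - 1 / (2 * ((n:ℝ) + 2) * ((n:ℝ) + 3)) =
                1 / (((n:ℝ) + 1) * ((n:ℝ) + 2) * ((n:ℝ) + 3)) := by
              field_simp
              ring
            rw [this]
            exact one_div_le_one_div_of_le (by positivity) (by nlinarith)
    refine (Finset.abs_sum_le_sum_abs _ _).trans ((Finset.sum_le_sum fun n _ => hterm n).trans ?_)
    rw [← Finset.mul_sum]
    refine mul_le_mul_of_nonneg_left (le_of_eq ?_) (by positivity)
    have := Finset.sum_range_sub' (fun n : ℕ => 1 / (2 * ((n:ℝ) + 1) * ((n:ℝ) + 2))) N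
    push_cast at this
    have h6 : ∀ n : ℕ, (n:ℝ) + 1 + 1 = n + 2 := fun n => by ring
    have h7 : ∀ n : ℕ, (n:ℝ) + 1 + 2 = n + 3 := fun n => by ring
    simp only [h6, h7] at this
    rw [this]
    norm_num
  have hpos : 0 ≤ L * |V - W| * (1 / (2 * ((N:ℝ) + 1) * ((N:ℝ) + 2))) := by positivity
  refine (abs_add_le _ _).trans ?_
  rw [abs_neg]
  linarith

/-- The transfer operator of the chain of pasts contracts Lipschitz constants. -/
lemma abs_sub_le_of_hasSum_digitProb (hV : V ∈ Set.Icc (0:ℝ) 1) (hW : W ∈ Set.Icc (0:ℝ) 1)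
    (hg : ∀ V ∈ Set.Icc (0:ℝ) 1, ∀ W ∈ Set.Icc (0:ℝ) 1, |g V - g W| ≤ L * |V - W|)
    (hU : ∀ V ∈ Set.Icc (0:ℝ) 1, HasSum (fun n => digitProb V n * g (gaussBranch n V)) (U V)) :
    |U V - U W| ≤ 7 / 8 * L * |V - W| := by
  have hL : 0 ≤ L := by
    have := (abs_nonneg _).trans (hg 0 (by simp) 1 (by simp))
    simpa using this
  have hS : Summable fun n => digitProb V n * g (gaussBranch n W) := by
    refine Summable.of_norm_bounded ((hasSum_digitProb hV).mul_right (|g 0| + L)).summable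
      fun n => ?_
    rw [Real.norm_eq_abs, abs_mul, abs_of_nonneg (digitProb_nonneg hV n)]
    exact mul_le_mul_of_nonneg_left (abs_le_of_lipschitz hg (gaussBranch_mem_Icc hW))
      (digitProb_nonneg hV n)
  have h1 := abs_tsum_digitProb_sub_le hV hW hL hg
  have e1 : ∑' n, digitProb V n * (g (gaussBranch n V) - g (gaussBranch n W)) =
      U V - ∑' n, digitProb V n * g (gaussBranch n W) := by
    simp only [mul_sub]
    rw [(hU V hV).summable.tsum_sub hS, (hU V hV).tsum_eq]
  rw [e1] at h1
  have h2 : |(∑' n, digitProb V n * g (gaussBranch n W)) - U W| ≤ 1 / 4 * L * |V - W| := by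
    have ht := (hS.hasSum.sub (hU W hW)).tendsto_sum_nat
    simp only [← sub_mul] at ht
    have ht2 : Tendsto (fun N : ℕ => 1 / 4 * L * |V - W| +
        |V - W| * (|g 0| + L) * (1 / ((N:ℝ) + 1))) atTop
        (𝓝 (1 / 4 * L * |V - W| + |V - W| * (|g 0| + L) * 0)) :=
      (tendsto_one_div_add_atTop_nhds_zero_nat.const_mul _).const_add _
    rw [mul_zero, add_zero] at ht2
    exact le_of_tendsto_of_tendsto' ht.abs ht2 fun N => abs_sum_digitProb_sub_le hV hW hg N
  have h3 := abs_sub_le (U V) (∑' n, digitProb V n * g (gaussBranch n W)) (U W)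
  linarith

lemma continuousOn_of_lipschitz
    (hg : ∀ V ∈ Set.Icc (0:ℝ) 1, ∀ W ∈ Set.Icc (0:ℝ) 1, |g V - g W| ≤ L * |V - W|) :
    ContinuousOn g (Set.Icc 0 1) := by
  refine (LipschitzOnWith.of_dist_le_mul (K := L.toNNReal) fun V hV W hW => ?_).continuousOn
  rw [Real.dist_eq, Real.dist_eq]
  exact (hg V hV W hW).trans
    (mul_le_mul_of_nonneg_right (Real.le_coe_toNNReal L) (abs_nonneg _))

lemma integrableOn_div_one_add (hg : ContinuousOn g (Set.Icc 0 1)) :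
    IntegrableOn (fun V => g V / (1 + V)) (Set.Ioo 0 1) := by
  refine (ContinuousOn.integrableOn_Icc ?_).mono_set Set.Ioo_subset_Icc_self
  refine hg.div (by fun_prop) fun V hV => ?_
  have := hV.1
  positivity

/-- The Gauss density is stationary for the chain of pasts. -/
lemma setIntegral_div_one_add_eq_of_hasSum_digitProb
    (hg : ∀ V ∈ Set.Icc (0:ℝ) 1, ∀ W ∈ Set.Icc (0:ℝ) 1, |g V - g W| ≤ L * |V - W|)
    (hU : ∀ V ∈ Set.Icc (0:ℝ) 1, HasSum (fun n => digitProb V n * g (gaussBranch n V)) (U V)) :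
    ∫ V in Set.Ioo (0:ℝ) 1, U V / (1 + V) = ∫ V in Set.Ioo (0:ℝ) 1, g V / (1 + V) := by
  have hc := continuousOn_of_lipschitz hg
  have h1 := hasSum_setIntegral_gaussBranch (integrableOn_div_one_add hc)
  have hbr : ∀ n : ℕ, ContinuousOn (gaussBranch n) (Set.Ioo 0 1) := by
    intro n
    unfold gaussBranch
    refine continuousOn_const.div (by fun_prop) fun V hV => ?_
    have := hV.1
    positivity
  have h2 : HasSum (fun n : ℕ => ∫ V in Set.Ioo (0:ℝ) 1,
      digitProb V n * g (gaussBranch n V) / (1 + V)) (∫ V in Set.Ioo (0:ℝ) 1, U V / (1 + V)) := by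
    refine hasSum_integral_of_dominated_convergence
      (fun n V => digitProb V n * (|g 0| + L)) (fun n => ?_) (fun n => ?_) ?_ ?_ ?_
    · refine ContinuousOn.aestronglyMeasurable ?_ measurableSet_Ioo
      refine ContinuousOn.div (ContinuousOn.mul ?_ ?_) (by fun_prop) fun V hV => ?_
      · unfold digitProb
        refine ContinuousOn.div (by fun_prop) (by fun_prop) fun V hV => ?_
        have := hV.1
        positivity
      · exact hc.comp (hbr n) fun V hV =>
          gaussBranch_mem_Icc (Set.Ioo_subset_Icc_self hV)
      · have := hV.1
        positivity
    · refine (ae_restrict_iff' measurableSet_Ioo).2 (ae_of_all _ fun V hV => ?_)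
      have hV' := Set.Ioo_subset_Icc_self hV
      have hV0 := hV.1
      rw [Real.norm_eq_abs, abs_div, abs_mul, abs_of_nonneg (digitProb_nonneg hV' n),
        abs_of_pos (by positivity : 0 < 1 + V)]
      refine (div_le_self (mul_nonneg (digitProb_nonneg hV' n) (abs_nonneg _))
        (by linarith)).trans ?_
      exact mul_le_mul_of_nonneg_left (abs_le_of_lipschitz hg (gaussBranch_mem_Icc hV'))
        (digitProb_nonneg hV' n)
    · refine (ae_restrict_iff' measurableSet_Ioo).2 (ae_of_all _ fun V hV => ?_)
      exact ((hasSum_digitProb (Set.Ioo_subset_Icc_self hV)).mul_right _).summable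
    · refine IntegrableOn.congr_fun (f := fun _ => |g 0| + L) (by simp)
        (fun V hV => ?_) measurableSet_Ioo
      rw [((hasSum_digitProb (Set.Ioo_subset_Icc_self hV)).mul_right _).tsum_eq, one_mul]
    · refine (ae_restrict_iff' measurableSet_Ioo).2 (ae_of_all _ fun V hV => ?_)
      exact (hU V (Set.Ioo_subset_Icc_self hV)).div_const _
  refine h2.unique ?_
  convert h1 using 1
  funext n
  refine setIntegral_congr_fun measurableSet_Ioo fun V hV => ?_
  have hV0 := hV.1
  have h3 : (n:ℝ) + 1 + V ≠ 0 := by positivity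
  have h4 : (n:ℝ) + 2 + V ≠ 0 := by positivity
  have h5 : 1 + V ≠ 0 := by positivity
  have h6 : 1 + gaussBranch n V = (n + 2 + V) / (n + 1 + V) := by
    rw [gaussBranch]
    field_simp
    ring
  simp only [h6]
  rw [digitProb]
  generalize g (gaussBranch n V) = y
  rw [gaussBranch]
  field_simp

lemma le_of_setIntegral_div_one_add_eq_zero
    (hg : ∀ V ∈ Set.Icc (0:ℝ) 1, ∀ W ∈ Set.Icc (0:ℝ) 1, |g V - g W| ≤ L * |V - W|)
    (h0 : ∫ V in Set.Ioo (0:ℝ) 1, g V / (1 + V) = 0) (hV : V ∈ Set.Icc (0:ℝ) 1) : g V ≤ L := by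
  by_contra! hlt
  have hL : 0 ≤ L := by
    have := (abs_nonneg _).trans (hg 0 (by simp) 1 (by simp))
    simpa using this
  have h1 : ∫ _ in Set.Ioo (0:ℝ) 1, (g V - L) / 2 ≤ ∫ W in Set.Ioo (0:ℝ) 1, g W / (1 + W) := by
    refine setIntegral_mono_on (by simp) (integrableOn_div_one_add (continuousOn_of_lipschitz hg))
      measurableSet_Ioo fun W hW => ?_
    have h2 := (abs_le.1 (hg V hV W (Set.Ioo_subset_Icc_self hW))).2
    have h3 : |V - W| ≤ 1 := by
      rw [abs_le]
      constructor <;> linarith [hV.1, hV.2, hW.1, hW.2]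
    have h4 : L * |V - W| ≤ L := mul_le_of_le_one_right hL h3
    have hW0 := hW.1
    rw [div_le_div_iff₀ (by norm_num) (by linarith)]
    nlinarith [hW.2]
  rw [h0] at h1
  simp at h1
  linarith

lemma abs_le_of_setIntegral_div_one_add_eq_zero
    (hg : ∀ V ∈ Set.Icc (0:ℝ) 1, ∀ W ∈ Set.Icc (0:ℝ) 1, |g V - g W| ≤ L * |V - W|)
    (h0 : ∫ V in Set.Ioo (0:ℝ) 1, g V / (1 + V) = 0) (hV : V ∈ Set.Icc (0:ℝ) 1) : |g V| ≤ L := by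
  rw [abs_le']
  refine ⟨le_of_setIntegral_div_one_add_eq_zero hg h0 hV,
    le_of_setIntegral_div_one_add_eq_zero (g := fun V => -g V) (fun V hV W hW => ?_) ?_ hV⟩
  · rw [neg_sub_neg, abs_sub_comm]
    exact hg V hV W hW
  · simp only [neg_div, integral_neg, h0, neg_zero]

end Transfer

/-- Bounded observables of the natural extension that are Lipschitz in the past, and Lipschitz in
the future on each branch of the Gauss map. -/
structure BranchLipschitz (F : ℝ × ℝ → ℝ) (B L : ℝ) : Prop where
  measurable : Measurable F
  abs_le : ∀ p, |F p| ≤ B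
  future : ∀ n : ℕ, ∀ s ∈ Set.Ioo (0:ℝ) 1, ∀ s' ∈ Set.Ioo (0:ℝ) 1, ∀ V ∈ Set.Icc (0:ℝ) 1,
    |F (gaussBranch n s, V) - F (gaussBranch n s', V)| ≤ L * |s - s'|
  past : ∀ t ∈ Set.Ioo (0:ℝ) 1, ∀ V ∈ Set.Icc (0:ℝ) 1, ∀ W ∈ Set.Icc (0:ℝ) 1,
    |F (t, V) - F (t, W)| ≤ L * |V - W|

/-- The conditional mean of `F` at time `k` given that the past at time `0` is `V`. -/
noncomputable def meanAfter (F : ℝ × ℝ → ℝ) (k : ℕ) (V : ℝ) : ℝ :=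
  futureMean V fun t => F (gaussNE^[k] (t, V))

section Observables

variable {F : ℝ × ℝ → ℝ} {B L V W : ℝ}

lemma Measurable.comp_gaussNE_iterate (hF : Measurable F) (k : ℕ) (V : ℝ) :
    Measurable fun t => F (gaussNE^[k] (t, V)) :=
  hF.comp ((measurable_gaussNE.iterate k).comp (measurable_id.prodMk measurable_const))

lemma hasSum_meanAfter_succ (hF : BranchLipschitz F B L) (k : ℕ) (hV : V ∈ Set.Icc (0:ℝ) 1) :
    HasSum (fun n => digitProb V n * meanAfter F k (gaussBranch n V))
      (meanAfter F (k + 1) V) := by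
  have h := hasSum_futureMean hV (hF.measurable.comp_gaussNE_iterate (k + 1) V)
    fun t _ => hF.abs_le _
  have e : ∀ n : ℕ, meanAfter F k (gaussBranch n V) = futureMean (gaussBranch n V)
      (fun s => F (gaussNE^[k + 1] (gaussBranch n s, V))) := fun n =>
    futureMean_congr fun s hs => by rw [Function.iterate_succ_apply, gaussNE_gaussBranch hs]
  simp only [e]
  exact h

lemma abs_futureDensity_sub_le (hV : V ∈ Set.Icc (0:ℝ) 1) (hW : W ∈ Set.Icc (0:ℝ) 1) {t : ℝ}
    (ht : t ∈ Set.Ioo (0:ℝ) 1) : |futureDensity V t - futureDensity W t| ≤ 4 * |V - W| := by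
  obtain ⟨hV0, hV1⟩ := hV
  obtain ⟨hW0, hW1⟩ := hW
  obtain ⟨ht0, ht1⟩ := ht
  have e : futureDensity V t - futureDensity W t =
      (V - W) * ((1 - 2 * t - t ^ 2 * (V + W) - t ^ 2 * V * W) /
        ((1 + t * V) ^ 2 * (1 + t * W) ^ 2)) := by
    have h1 : 1 + t * V ≠ 0 := by positivity
    have h2 : 1 + t * W ≠ 0 := by positivity
    unfold futureDensity
    field_simp
    ring
  rw [e, abs_mul, mul_comm, abs_div]
  refine mul_le_mul_of_nonneg_right ?_ (abs_nonneg _)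
  have hd : 1 ≤ (1 + t * V) ^ 2 * (1 + t * W) ^ 2 :=
    one_le_mul_of_one_le_of_one_le (one_le_pow₀ (by nlinarith)) (one_le_pow₀ (by nlinarith))
  rw [abs_of_nonneg (zero_le_one.trans hd)]
  refine (div_le_self (abs_nonneg _) hd).trans ?_
  have h3 : 0 ≤ t ^ 2 := by positivity
  have h4 : t ^ 2 ≤ 1 := by nlinarith
  have h5 : 0 ≤ V * W := by positivity
  have h6 : V * W ≤ 1 := by nlinarith
  have h7 : t ^ 2 * (V + W) ≤ 2 := by nlinarith
  have h8 : t ^ 2 * (V * W) ≤ 1 := by nlinarith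
  have h9 : 0 ≤ t ^ 2 * (V + W) := by positivity
  have h10 : 0 ≤ t ^ 2 * (V * W) := by positivity
  have h11 : t ^ 2 * V * W = t ^ 2 * (V * W) := by ring
  rw [h11, abs_le]
  constructor <;> linarith

lemma abs_meanAfter_zero_sub_le (hF : BranchLipschitz F B L) (hV : V ∈ Set.Icc (0:ℝ) 1)
    (hW : W ∈ Set.Icc (0:ℝ) 1) :
    |meanAfter F 0 V - meanAfter F 0 W| ≤ (2 * L + 4 * B) * |V - W| := by
  have hm := fun V => hF.measurable.comp_gaussNE_iterate 0 V
  have hi := fun V (hV : V ∈ Set.Icc (0:ℝ) 1) =>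
    integrableOn_futureDensity_mul hV (hm V) (fun t _ => hF.abs_le _)
  rw [meanAfter, meanAfter, futureMean, futureMean, ← integral_sub (hi V hV) (hi W hW),
    ← Real.norm_eq_abs]
  refine (norm_setIntegral_le_of_norm_le_const (C := (2 * L + 4 * B) * |V - W|) (by simp)
    fun t ht => ?_).trans (by simp)
  simp only [Function.iterate_zero, id, Real.norm_eq_abs]
  have e : futureDensity V t * F (t, V) - futureDensity W t * F (t, W) =
      futureDensity V t * (F (t, V) - F (t, W)) +
        (futureDensity V t - futureDensity W t) * F (t, W) := by ring
  rw [e]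
  refine (abs_add_le _ _).trans ?_
  rw [abs_mul, abs_mul, abs_of_pos (futureDensity_pos hV ht)]
  have h1 := mul_le_mul (futureDensity_le_two hV ht) (hF.past t ht V hV W hW) (abs_nonneg _)
    (by norm_num)
  have h2 := mul_le_mul (abs_futureDensity_sub_le hV hW ht) (hF.abs_le (t, W)) (abs_nonneg _)
    (by positivity)
  linarith

lemma abs_meanAfter_sub_le (hF : BranchLipschitz F B L) (k : ℕ) :
    ∀ V ∈ Set.Icc (0:ℝ) 1, ∀ W ∈ Set.Icc (0:ℝ) 1,
      |meanAfter F k V - meanAfter F k W| ≤ (2 * L + 4 * B) * (7 / 8) ^ k * |V - W| := by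
  induction k with
  | zero =>
    intro V hV W hW
    simpa using abs_meanAfter_zero_sub_le hF hV hW
  | succ k ih =>
    intro V hV W hW
    have := abs_sub_le_of_hasSum_digitProb hV hW ih fun V hV => hasSum_meanAfter_succ hF k hV
    rw [pow_succ]
    linarith

lemma setIntegral_meanAfter (hF : BranchLipschitz F B L) (k : ℕ) :
    ∫ V in Set.Ioo (0:ℝ) 1, meanAfter F k V / (1 + V) =
      ∫ V in Set.Ioo (0:ℝ) 1, meanAfter F 0 V / (1 + V) := by
  induction k with
  | zero => rfl
  | succ k ih =>
    rw [← ih]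
    exact setIntegral_div_one_add_eq_of_hasSum_digitProb (abs_meanAfter_sub_le hF k)
      fun V hV => hasSum_meanAfter_succ hF k hV

lemma abs_meanAfter_le (hF : BranchLipschitz F B L)
    (h0 : ∫ V in Set.Ioo (0:ℝ) 1, meanAfter F 0 V / (1 + V) = 0) (k : ℕ)
    (hV : V ∈ Set.Icc (0:ℝ) 1) : |meanAfter F k V| ≤ (2 * L + 4 * B) * (7 / 8) ^ k :=
  abs_le_of_setIntegral_div_one_add_eq_zero (abs_meanAfter_sub_le hF k)
    (by rw [setIntegral_meanAfter hF, h0]) hV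

lemma BranchLipschitz.bound_nonneg (hF : BranchLipschitz F B L) : 0 ≤ B :=
  (abs_nonneg _).trans (hF.abs_le 0)

lemma BranchLipschitz.const_nonneg (hF : BranchLipschitz F B L) : 0 ≤ L := by
  have := (abs_nonneg _).trans
    (hF.past (1 / 2) (by norm_num) 0 (by simp) 1 (by simp))
  simpa using this

/-- Branches of the Gauss map contract the metric `|1 / (1 + s) - 1 / (1 + s')|`. -/
lemma abs_one_div_one_add_gaussBranch_sub_le (n : ℕ) {s s' : ℝ} (hs : s ∈ Set.Ioo (0:ℝ) 1)
    (hs' : s' ∈ Set.Ioo (0:ℝ) 1) :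
    |1 / (1 + gaussBranch n s) - 1 / (1 + gaussBranch n s')| ≤
      4 / 9 * |1 / (1 + s) - 1 / (1 + s')| := by
  obtain ⟨h0, h1⟩ := hs
  obtain ⟨h0', h1'⟩ := hs'
  have hn : (0:ℝ) ≤ n := n.cast_nonneg
  have e : ∀ s : ℝ, 0 < s → 1 / (1 + gaussBranch n s) = (n + 1 + s) / (n + 2 + s) := by
    intro s hs
    unfold gaussBranch
    have h3 : (n:ℝ) + 1 + s ≠ 0 := by positivity
    have h4 : (n:ℝ) + 2 + s ≠ 0 := by positivity
    have h5 : 1 + 1 / ((n:ℝ) + 1 + s) = (n + 2 + s) / (n + 1 + s) := by field_simp; ring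
    rw [h5, one_div_div]
  have e1 : 1 / (1 + gaussBranch n s) - 1 / (1 + gaussBranch n s') =
      (s - s') / ((n + 2 + s) * (n + 2 + s')) := by
    rw [e s h0, e s' h0']
    field_simp
    ring
  have e2 : 1 / (1 + s) - 1 / (1 + s') = (s' - s) / ((1 + s) * (1 + s')) := by
    field_simp
    ring
  rw [e1, e2, abs_div, abs_div, abs_sub_comm s' s,
    abs_of_pos (by positivity : 0 < ((n:ℝ) + 2 + s) * (n + 2 + s')),
    abs_of_pos (by positivity : 0 < (1 + s) * (1 + s')), ← mul_div_assoc, mul_comm (4 / 9 : ℝ),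
    mul_div_assoc, div_eq_mul_one_div |s - s'|]
  refine mul_le_mul_of_nonneg_left ?_ (abs_nonneg _)
  rw [div_le_div_iff₀ (by positivity) (by positivity), one_mul]
  have h2 : 3 / 2 * (1 + s) ≤ n + 2 + s := by linarith
  have h3 : 3 / 2 * (1 + s') ≤ n + 2 + s' := by linarith
  have := mul_le_mul h2 h3 (by positivity) (by positivity)
  linarith

/-- Exponential decay of correlations between a Lipschitz function of the future and an observable
of mean zero. -/
lemma abs_futureMean_mul_le {G K : ℝ} (hF : BranchLipschitz F B L)
    (hG : ∀ k, ∀ V ∈ Set.Icc (0:ℝ) 1, |meanAfter F k V| ≤ G * (7 / 8) ^ k) (hBK : B ≤ K)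
    (hGK : G + 4 / 9 * K ≤ 7 / 8 * K) (k : ℕ) :
    ∀ (f : ℝ → ℝ) (M l V : ℝ), 0 ≤ l → V ∈ Set.Icc (0:ℝ) 1 → Measurable f →
      (∀ t ∈ Set.Ioo (0:ℝ) 1, |f t| ≤ M) →
      (∀ s ∈ Set.Ioo (0:ℝ) 1, ∀ s' ∈ Set.Ioo (0:ℝ) 1,
        |f s - f s'| ≤ l * |1 / (1 + s) - 1 / (1 + s')|) →
      |futureMean V (fun t => f t * F (gaussNE^[k] (t, V)))| ≤ (M * G + l * K) * (7 / 8) ^ k := by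
  have hB := hF.bound_nonneg
  have hhalf : (1 / 2 : ℝ) ∈ Set.Ioo (0:ℝ) 1 := by norm_num
  have key : ∀ k : ℕ, ∀ (f : ℝ → ℝ) (M l V : ℝ), 0 ≤ l → V ∈ Set.Icc (0:ℝ) 1 → Measurable f →
      (∀ t ∈ Set.Ioo (0:ℝ) 1, |f t| ≤ M) →
      (∀ s ∈ Set.Ioo (0:ℝ) 1, ∀ s' ∈ Set.Ioo (0:ℝ) 1,
        |f s - f s'| ≤ l * |1 / (1 + s) - 1 / (1 + s')|) →
      (∀ g : ℝ → ℝ, Measurable g → (∀ t ∈ Set.Ioo (0:ℝ) 1, |g t| ≤ l) →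
        (∀ s ∈ Set.Ioo (0:ℝ) 1, ∀ s' ∈ Set.Ioo (0:ℝ) 1,
          |g s - g s'| ≤ l * |1 / (1 + s) - 1 / (1 + s')|) →
        |futureMean V (fun t => g t * F (gaussNE^[k] (t, V)))| ≤ l * K * (7 / 8) ^ k) →
      |futureMean V (fun t => f t * F (gaussNE^[k] (t, V)))| ≤
        (M * G + l * K) * (7 / 8) ^ k := by
    intro k f M l V hl hV hf hM hlip hg
    have hm := hF.measurable.comp_gaussNE_iterate k V
    have hgb : ∀ t ∈ Set.Ioo (0:ℝ) 1, |f t - f (1 / 2)| ≤ l := by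
      intro t ht
      refine (hlip t ht _ hhalf).trans (mul_le_of_le_one_right hl ?_)
      have h1 : 1 / (1 + t) ≤ 1 := by
        rw [div_le_one (by linarith [ht.1])]
        linarith [ht.1]
      have h2 : 0 < 1 / (1 + t) := by
        have := ht.1
        positivity
      have h3 : (1:ℝ) / (1 + 1 / 2) = 2 / 3 := by norm_num
      rw [h3, abs_le]
      constructor <;> linarith
    have hsplit : futureMean V (fun t => f t * F (gaussNE^[k] (t, V))) =
        f (1 / 2) * meanAfter F k V +
          futureMean V (fun t => (f t - f (1 / 2)) * F (gaussNE^[k] (t, V))) := by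
      rw [meanAfter, ← futureMean_const_mul,
        ← futureMean_add (H := fun t => f (1 / 2) * F (gaussNE^[k] (t, V)))
        (K := fun t => (f t - f (1 / 2)) * F (gaussNE^[k] (t, V)))
        (B := |f (1 / 2)| * B) (C := l * B)
        hV (hm.const_mul _) ((hf.sub_const _).mul hm)]
      · refine futureMean_congr fun t _ => ?_
        ring
      · intro t _
        rw [abs_mul]
        exact mul_le_mul_of_nonneg_left (hF.abs_le _) (abs_nonneg _)
      · intro t ht
        rw [abs_mul]
        exact mul_le_mul (hgb t ht) (hF.abs_le _) (abs_nonneg _) hl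
    rw [hsplit]
    refine (abs_add_le _ _).trans ?_
    have h1 : |f (1 / 2) * meanAfter F k V| ≤ M * (G * (7 / 8) ^ k) := by
      rw [abs_mul]
      exact mul_le_mul (hM _ hhalf) (hG k V hV) (abs_nonneg _)
        ((abs_nonneg _).trans (hM _ hhalf))
    have h2 := hg (fun t => f t - f (1 / 2)) (hf.sub_const _) hgb fun s hs s' hs' => by
      rw [sub_sub_sub_cancel_right]
      exact hlip s hs s' hs'
    linarith
  induction k with
  | zero =>
    intro f M l V hl hV hf hM hlip
    refine key 0 f M l V hl hV hf hM hlip fun g hg hgl _ => ?_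
    rw [pow_zero, mul_one]
    refine abs_futureMean_le (H := fun t => g t * F (gaussNE^[0] (t, V))) hV
      (hg.mul (hF.measurable.comp_gaussNE_iterate 0 V)) fun t ht => ?_
    rw [abs_mul]
    exact mul_le_mul (hgl t ht) ((hF.abs_le _).trans hBK) (abs_nonneg _) hl
  | succ k ih =>
    intro f M l V hl hV hf hM hlip
    refine key (k + 1) f M l V hl hV hf hM hlip fun g hg hgl hglip => ?_
    have hm := hF.measurable.comp_gaussNE_iterate (k + 1) V
    have h := hasSum_futureMean (H := fun t => g t * F (gaussNE^[k + 1] (t, V))) (B := l * B) hV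
      (hg.mul hm) fun t ht => by
      rw [abs_mul]
      exact mul_le_mul (hgl t ht) (hF.abs_le _) (abs_nonneg _) hl
    refine h.abs_le_of_digitProb hV fun n => ?_
    have e : futureMean (gaussBranch n V) (fun s => g (gaussBranch n s) *
        F (gaussNE^[k + 1] (gaussBranch n s, V))) = futureMean (gaussBranch n V)
        (fun s => g (gaussBranch n s) * F (gaussNE^[k] (s, gaussBranch n V))) :=
      futureMean_congr fun s hs => by rw [Function.iterate_succ_apply, gaussNE_gaussBranch hs]
    rw [e]
    refine (ih (fun s => g (gaussBranch n s)) l (4 / 9 * l) _ (by positivity)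
      (gaussBranch_mem_Icc hV) (hg.comp measurable_gaussBranch)
      (fun t ht => hgl _ (gaussBranch_mem_Ioo ht)) fun s hs s' hs' => ?_).trans ?_
    · refine (hglip _ (gaussBranch_mem_Ioo hs) _ (gaussBranch_mem_Ioo hs')).trans ?_
      rw [mul_comm (4 / 9 : ℝ) l, mul_assoc]
      exact mul_le_mul_of_nonneg_left (abs_one_div_one_add_gaussBranch_sub_le n hs hs') hl
    · have h1 := mul_le_mul_of_nonneg_left hGK hl
      have h2 : (0:ℝ) ≤ (7 / 8) ^ k := by positivity
      have h3 := mul_le_mul_of_nonneg_right h1 h2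
      rw [pow_succ]
      linarith

/-- Exponential decay of autocorrelations of an observable of mean zero. -/
lemma exists_abs_autocorrelation_le (hF : BranchLipschitz F B L)
    (h0 : ∫ V in Set.Ioo (0:ℝ) 1, meanAfter F 0 V / (1 + V) = 0) :
    ∃ C : ℝ, 0 ≤ C ∧ ∀ k : ℕ, ∀ V ∈ Set.Icc (0:ℝ) 1,
      |futureMean V (fun t => F (t, V) * F (gaussNE^[k + 1] (t, V)))| ≤ C * (7 / 8) ^ k := by
  have hB := hF.bound_nonneg
  have hL := hF.const_nonneg
  set G := 2 * L + 4 * B with hGdef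
  set K := B + 3 * G with hK
  have hGnn : 0 ≤ G := by positivity
  refine ⟨B * G + 4 * L * K, by positivity, fun k V hV => ?_⟩
  have hm0 : Measurable fun t => F (t, V) := hF.measurable.comp_gaussNE_iterate 0 V
  have hm := hF.measurable.comp_gaussNE_iterate (k + 1) V
  have h := hasSum_futureMean (H := fun t => F (t, V) * F (gaussNE^[k + 1] (t, V))) (B := B * B) hV
    (hm0.mul hm) fun t ht => by
    rw [abs_mul]
    exact mul_le_mul (hF.abs_le _) (hF.abs_le _) (abs_nonneg _) hB
  refine h.abs_le_of_digitProb hV fun n => ?_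
  have e : futureMean (gaussBranch n V) (fun s => F (gaussBranch n s, V) *
      F (gaussNE^[k + 1] (gaussBranch n s, V))) = futureMean (gaussBranch n V)
      (fun s => F (gaussBranch n s, V) * F (gaussNE^[k] (s, gaussBranch n V))) :=
    futureMean_congr fun s hs => by rw [Function.iterate_succ_apply, gaussNE_gaussBranch hs]
  rw [e]
  refine abs_futureMean_mul_le hF (fun k V hV => abs_meanAfter_le hF h0 k hV) (by linarith)
    (by linarith) k (fun s => F (gaussBranch n s, V)) B (4 * L) _ (by positivity)
    (gaussBranch_mem_Icc hV) (hm0.comp measurable_gaussBranch) (fun t _ => hF.abs_le _)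
    fun s hs s' hs' => (hF.future n s hs s' hs' V hV).trans ?_
  obtain ⟨h1, h2⟩ := hs
  obtain ⟨h1', h2'⟩ := hs'
  have e2 : 1 / (1 + s) - 1 / (1 + s') = (s' - s) / ((1 + s) * (1 + s')) := by
    field_simp
    ring
  rw [e2, abs_div, abs_sub_comm s' s, abs_of_pos (by positivity : 0 < (1 + s) * (1 + s')),
    mul_comm (4:ℝ) L, mul_assoc]
  refine mul_le_mul_of_nonneg_left ?_ hL
  rw [← mul_div_assoc, le_div_iff₀ (by positivity), mul_comm]
  refine mul_le_mul_of_nonneg_right ?_ (abs_nonneg _)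
  nlinarith

lemma Measurable.birkhoffSum_gaussNE (hF : Measurable F) (n : ℕ) :
    Measurable (birkhoffSum gaussNE F n) := by
  unfold birkhoffSum
  exact Finset.measurable_fun_sum _ fun k _ => hF.comp (measurable_gaussNE.iterate k)

lemma BranchLipschitz.abs_birkhoffSum_le (hF : BranchLipschitz F B L) (n : ℕ) (p : ℝ × ℝ) :
    |birkhoffSum gaussNE F n p| ≤ n * B := by
  unfold birkhoffSum
  refine (Finset.abs_sum_le_sum_abs _ _).trans
    ((Finset.sum_le_sum fun k _ => hF.abs_le _).trans ?_)
  simp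

/-- The second moment of the Birkhoff sums of an observable of mean zero grows at most linearly. -/
lemma exists_futureMean_birkhoffSum_sq_le (hF : BranchLipschitz F B L)
    (h0 : ∫ V in Set.Ioo (0:ℝ) 1, meanAfter F 0 V / (1 + V) = 0) :
    ∃ C : ℝ, 0 ≤ C ∧ ∀ n : ℕ, ∀ V ∈ Set.Icc (0:ℝ) 1,
      futureMean V (fun t => birkhoffSum gaussNE F n (t, V) ^ 2) ≤ C * n := by
  obtain ⟨A, hA, hcorr⟩ := exists_abs_autocorrelation_le hF h0
  have hB := hF.bound_nonneg
  have hSmT : ∀ n V, Measurable fun t => birkhoffSum gaussNE F n (gaussNE (t, V)) := fun n V =>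
    ((hF.measurable.birkhoffSum_gaussNE n).comp measurable_gaussNE).comp (measurable_id.prodMk measurable_const)
  have hSb := hF.abs_birkhoffSum_le
  refine ⟨B ^ 2 + 16 * A, by positivity, fun n => ?_⟩
  induction n with
  | zero =>
    intro V hV
    have : futureMean V (fun _ => (0:ℝ)) = 0 := futureMean_const hV 0
    simp [this]
  | succ n ih =>
    intro V hV
    have hm0 : Measurable fun t => F (t, V) := hF.measurable.comp_gaussNE_iterate 0 V
    have hcross : |futureMean V (fun t => F (t, V) * birkhoffSum gaussNE F n (gaussNE (t, V)))| ≤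
        8 * A := by
      have e : futureMean V (fun t => F (t, V) * birkhoffSum gaussNE F n (gaussNE (t, V))) =
          ∑ k ∈ Finset.range n, futureMean V (fun t => F (t, V) * F (gaussNE^[k + 1] (t, V))) := by
        unfold futureMean
        rw [← integral_finsetSum]
        · simp only [birkhoffSum, Finset.mul_sum, Function.iterate_succ_apply]
        · intro k _
          refine integrableOn_futureDensity_mul (B := B * B) hV
            (hm0.mul (hF.measurable.comp_gaussNE_iterate (k + 1) V)) fun t _ => ?_
          rw [abs_mul]
          exact mul_le_mul (hF.abs_le _) (hF.abs_le _) (abs_nonneg _) hB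
      rw [e]
      refine (Finset.abs_sum_le_sum_abs _ _).trans
        ((Finset.sum_le_sum fun k _ => hcorr k V hV).trans ?_)
      rw [← Finset.mul_sum, mul_comm]
      refine mul_le_mul_of_nonneg_right ?_ hA
      rw [geom_sum_eq (by norm_num)]
      have : (0:ℝ) ≤ (7 / 8) ^ n := by positivity
      rw [div_le_iff_of_neg (by norm_num)]
      linarith
    have hsq : futureMean V (fun t => birkhoffSum gaussNE F n (gaussNE (t, V)) ^ 2) ≤
        (B ^ 2 + 16 * A) * n := by
      have hb : ∀ p, |birkhoffSum gaussNE F n p ^ 2| ≤ (n * B) ^ 2 := fun p => by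
        rw [abs_pow]
        exact pow_le_pow_left₀ (abs_nonneg _) (hSb n p) 2
      have h := hasSum_futureMean (H := fun t => birkhoffSum gaussNE F n (gaussNE (t, V)) ^ 2) hV
        ((hSmT n V).pow_const 2) fun t _ => hb _
      refine le_trans (le_abs_self _) (h.abs_le_of_digitProb hV fun m => ?_)
      have e : futureMean (gaussBranch m V)
          (fun s => birkhoffSum gaussNE F n (gaussNE (gaussBranch m s, V)) ^ 2) =
          futureMean (gaussBranch m V)
          (fun s => birkhoffSum gaussNE F n (s, gaussBranch m V) ^ 2) :=
        futureMean_congr fun s hs => by rw [gaussNE_gaussBranch hs]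
      rw [e, abs_of_nonneg]
      · exact ih _ (gaussBranch_mem_Icc hV)
      · exact setIntegral_nonneg measurableSet_Ioo fun t ht =>
          mul_nonneg (futureDensity_pos (gaussBranch_mem_Icc hV) ht).le (sq_nonneg _)
    have hFsq : futureMean V (fun t => F (t, V) ^ 2) ≤ B ^ 2 := by
      refine (le_abs_self _).trans (abs_futureMean_le (H := fun t => F (t, V) ^ 2) hV
        (hm0.pow_const 2) fun t _ => ?_)
      rw [abs_pow]
      exact pow_le_pow_left₀ (abs_nonneg _) (hF.abs_le _) 2
    have hexp : futureMean V (fun t => birkhoffSum gaussNE F (n + 1) (t, V) ^ 2) =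
        futureMean V (fun t => F (t, V) ^ 2) +
        2 * futureMean V (fun t => F (t, V) * birkhoffSum gaussNE F n (gaussNE (t, V))) +
        futureMean V (fun t => birkhoffSum gaussNE F n (gaussNE (t, V)) ^ 2) := by
      have b1 : ∀ t ∈ Set.Ioo (0:ℝ) 1, |F (t, V) ^ 2| ≤ B ^ 2 := fun t _ => by
        rw [abs_pow]
        exact pow_le_pow_left₀ (abs_nonneg _) (hF.abs_le _) 2
      have b2 : ∀ t ∈ Set.Ioo (0:ℝ) 1,
          |2 * (F (t, V) * birkhoffSum gaussNE F n (gaussNE (t, V)))| ≤ 2 * (B * (n * B)) :=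
        fun t _ => by
          rw [abs_mul, abs_mul, abs_two]
          exact mul_le_mul_of_nonneg_left
            (mul_le_mul (hF.abs_le _) (hSb n _) (abs_nonneg _) hB) (by norm_num)
      have b3 : ∀ t ∈ Set.Ioo (0:ℝ) 1,
          |birkhoffSum gaussNE F n (gaussNE (t, V)) ^ 2| ≤ (n * B) ^ 2 := fun t _ => by
        rw [abs_pow]
        exact pow_le_pow_left₀ (abs_nonneg _) (hSb n _) 2
      rw [← futureMean_const_mul, ← futureMean_add (H := fun t => F (t, V) ^ 2)
        (K := fun t => 2 * (F (t, V) * birkhoffSum gaussNE F n (gaussNE (t, V)))) hV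
        (hm0.pow_const 2) ((hm0.mul (hSmT n V)).const_mul 2) b1 b2,
        ← futureMean_add (H := fun t => F (t, V) ^ 2 +
          2 * (F (t, V) * birkhoffSum gaussNE F n (gaussNE (t, V))))
        (K := fun t => birkhoffSum gaussNE F n (gaussNE (t, V)) ^ 2) hV
        ((hm0.pow_const 2).add ((hm0.mul (hSmT n V)).const_mul 2)) ((hSmT n V).pow_const 2)
        (fun t ht => (abs_add_le _ _).trans (add_le_add (b1 t ht) (b2 t ht))) b3]
      refine futureMean_congr fun t _ => ?_
      rw [birkhoffSum_succ']
      ring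
    rw [hexp]
    have := (abs_le.1 hcross).2
    push_cast
    linarith

end Observables

section LawOfLargeNumbers

/-- Control of the averages along the squares suffices when the increments are bounded. -/
lemma tendsto_div_of_tendsto_sq {u : ℕ → ℝ} {B : ℝ} (hu : ∀ n, |u (n + 1) - u n| ≤ B)
    (h : Tendsto (fun m : ℕ => u (m ^ 2) / (m:ℝ) ^ 2) atTop (𝓝 0)) :
    Tendsto (fun n : ℕ => u n / n) atTop (𝓝 0) := by
  have hB : 0 ≤ B := (abs_nonneg _).trans (hu 0)
  have hgap : ∀ m k, |u (m + k) - u m| ≤ k * B := by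
    intro m k
    induction k with
    | zero => simp
    | succ k ih =>
      have e : u (m + (k + 1)) - u m = (u (m + k + 1) - u (m + k)) + (u (m + k) - u m) := by
        rw [add_assoc]
        ring
      rw [e]
      refine (abs_add_le _ _).trans ?_
      have := hu (m + k)
      push_cast
      linarith
  have hsqrt : Tendsto Nat.sqrt atTop atTop :=
    tendsto_atTop_atTop.2 fun b => ⟨b * b, fun n hn => Nat.le_sqrt.2 hn⟩
  have h1 : Tendsto (fun m : ℕ => |u (m ^ 2) / (m:ℝ) ^ 2| + 2 * B / m) atTop (𝓝 0) := by
    simpa using h.abs.add (tendsto_const_div_atTop_nhds_zero_nat (2 * B))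
  refine squeeze_zero_norm' ?_ (h1.comp hsqrt)
  filter_upwards [eventually_ge_atTop 1] with n hn
  have hm1 : 1 ≤ n.sqrt := Nat.le_sqrt.2 (by simpa using hn)
  have hmn : n.sqrt ^ 2 ≤ n := Nat.sqrt_le' n
  have hnm : n ≤ n.sqrt * n.sqrt + n.sqrt + n.sqrt := Nat.sqrt_le_add n
  simp only [Function.comp_apply, Real.norm_eq_abs]
  generalize n.sqrt = m at *
  obtain ⟨k, rfl⟩ := Nat.exists_eq_add_of_le hmn
  have hk : k ≤ 2 * m := by nlinarith
  have hkr : (k:ℝ) ≤ 2 * m := by exact_mod_cast hk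
  have hm0 : (0:ℝ) < m := by exact_mod_cast hm1
  have hg := hgap (m ^ 2) k
  have h2 : |u (m ^ 2 + k)| ≤ |u (m ^ 2)| + 2 * m * B := by
    have := abs_sub_abs_le_abs_sub (u (m ^ 2 + k)) (u (m ^ 2))
    have := mul_le_mul_of_nonneg_right hkr hB
    linarith
  rw [abs_div, abs_div, Nat.abs_cast, abs_of_pos (by positivity : 0 < (m:ℝ) ^ 2)]
  have e : |u (m ^ 2)| / (m:ℝ) ^ 2 + 2 * B / m = (|u (m ^ 2)| + 2 * m * B) / (m:ℝ) ^ 2 := by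
    field_simp
  rw [e]
  refine div_le_div₀ (by positivity) h2 (by positivity) ?_
  exact_mod_cast hmn

variable {F : ℝ × ℝ → ℝ} {B L : ℝ}

lemma futureMean_zero (H : ℝ → ℝ) : futureMean 0 H = ∫ t in Set.Ioo (0:ℝ) 1, H t := by
  simp [futureMean, futureDensity]

lemma ae_tendsto_birkhoffSum_div_of_mean_zero (hF : BranchLipschitz F B L)
    (h0 : ∫ V in Set.Ioo (0:ℝ) 1, meanAfter F 0 V / (1 + V) = 0) :
    ∀ᵐ x ∂volume.restrict (Set.Ioo (0:ℝ) 1),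
      Tendsto (fun n : ℕ => birkhoffSum gaussNE F n (x, 0) / n) atTop (𝓝 0) := by
  obtain ⟨C, hC, hvar⟩ := exists_futureMean_birkhoffSum_sq_le hF h0
  set g : ℕ → ℝ → ℝ := fun m x =>
    (birkhoffSum gaussNE F ((m + 1) ^ 2) (x, 0) / ((m:ℝ) + 1) ^ 2) ^ 2 with hg
  have hgm : ∀ m, Measurable (g m) := fun m =>
    (((hF.measurable.birkhoffSum_gaussNE _).comp
      (measurable_id.prodMk measurable_const)).div_const _).pow_const 2
  have hbound_sq : ∀ m, ∫ x in Set.Ioo (0:ℝ) 1, g m x ≤ C * (1 / ((m:ℝ) + 1) ^ 2) := by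
    intro m
    have h1 := hvar ((m + 1) ^ 2) 0 (by simp)
    rw [futureMean_zero] at h1
    simp only [hg, div_pow, integral_div]
    rw [div_le_iff₀ (by positivity)]
    refine h1.trans (le_of_eq ?_)
    push_cast
    field_simp
  have hsum : Summable fun m : ℕ => C * (1 / ((m:ℝ) + 1) ^ 2) := by
    refine Summable.mul_left C ?_
    have := (summable_nat_add_iff 1).2 (Real.summable_one_div_nat_pow.2 one_lt_two)
    exact_mod_cast this
  have hlint : ∑' m, ∫⁻ x in Set.Ioo (0:ℝ) 1, ENNReal.ofReal (g m x) ≠ ⊤ := by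
    refine ne_top_of_le_ne_top hsum.tsum_ofReal_ne_top (ENNReal.tsum_le_tsum fun m => ?_)
    have hb : ∀ x ∈ Set.Ioo (0:ℝ) 1, |g m x| ≤ (B : ℝ) ^ 2 := by
      intro x _
      have h1 := hF.abs_birkhoffSum_le ((m + 1) ^ 2) (x, 0)
      push_cast at h1
      rw [hg, abs_pow]
      refine pow_le_pow_left₀ (abs_nonneg _) ?_ 2
      rw [abs_div, abs_of_pos (by positivity : 0 < ((m:ℝ) + 1) ^ 2), div_le_iff₀ (by positivity)]
      linarith
    rw [← ofReal_integral_eq_lintegral_ofReal (integrableOn_of_bound (hgm m) hb)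
      (ae_of_all _ fun x => sq_nonneg _)]
    exact ENNReal.ofReal_le_ofReal (hbound_sq m)
  rw [← lintegral_tsum fun m => (hgm m).ennreal_ofReal.aemeasurable] at hlint
  filter_upwards [ae_lt_top (Measurable.tsum fun m => (hgm m).ennreal_ofReal) hlint]
    with x hx
  have h1 := ENNReal.tendsto_atTop_zero_of_tsum_ne_top hx.ne
  have h2 : Tendsto (fun m => g m x) atTop (𝓝 0) := by
    have := (ENNReal.tendsto_toReal ENNReal.zero_ne_top).comp h1
    simpa [Function.comp_def, hg, sq_nonneg, ENNReal.toReal_ofReal] using this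
  refine tendsto_div_of_tendsto_sq (B := B) (fun n => ?_) ?_
  · rw [birkhoffSum_succ, add_sub_cancel_left]
    exact hF.abs_le _
  · rw [← tendsto_add_atTop_iff_nat 1]
    have h3 := (Real.continuous_sqrt.tendsto 0).comp h2
    rw [Real.sqrt_zero] at h3
    refine tendsto_zero_iff_abs_tendsto_zero _ |>.2 (h3.congr fun m => ?_)
    simp only [Function.comp_apply, hg, Real.sqrt_sq_eq_abs]
    push_cast
    rfl

lemma setIntegral_one_div_one_add : ∫ V in Set.Ioo (0:ℝ) 1, 1 / (1 + V) = Real.log 2 := by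
  rw [← integral_Ioc_eq_integral_Ioo, ← intervalIntegral.integral_of_le zero_le_one,
    intervalIntegral.integral_comp_add_left (fun x => 1 / x) 1, integral_one_div_of_pos] <;> norm_num

/-- Strong law of large numbers for the natural extension of the Gauss map, along points with
trivial past. -/
theorem ae_tendsto_birkhoffSum_div (hF : BranchLipschitz F B L) :
    ∀ᵐ x ∂volume.restrict (Set.Ioo (0:ℝ) 1),
      Tendsto (fun n : ℕ => birkhoffSum gaussNE F n (x, 0) / n) atTop
        (𝓝 ((∫ V in Set.Ioo (0:ℝ) 1, meanAfter F 0 V / (1 + V)) / Real.log 2)) := by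
  set c := (∫ V in Set.Ioo (0:ℝ) 1, meanAfter F 0 V / (1 + V)) / Real.log 2 with hc
  have hlog : Real.log 2 ≠ 0 := (Real.log_pos one_lt_two).ne'
  have hG : BranchLipschitz (fun p => F p - c) (B + |c|) L :=
    { measurable := hF.measurable.sub_const c
      abs_le := fun p => (abs_sub _ _).trans (add_le_add_left (hF.abs_le p) _)
      future := fun n s hs s' hs' V hV => by simpa using hF.future n s hs s' hs' V hV
      past := fun t ht V hV W hW => by simpa using hF.past t ht V hV W hW }
  have hmean : ∀ V ∈ Set.Icc (0:ℝ) 1,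
      meanAfter (fun p => F p - c) 0 V = meanAfter F 0 V + -c := by
    intro V hV
    rw [meanAfter, meanAfter, ← futureMean_const hV (-c), ← futureMean_add hV
      (hF.measurable.comp_gaussNE_iterate 0 V) measurable_const (fun t _ => hF.abs_le _)
      (fun t _ => le_rfl)]
    rfl
  have h0 : ∫ V in Set.Ioo (0:ℝ) 1, meanAfter (fun p => F p - c) 0 V / (1 + V) = 0 := by
    have e : ∫ V in Set.Ioo (0:ℝ) 1, meanAfter (fun p => F p - c) 0 V / (1 + V) =
        ∫ V in Set.Ioo (0:ℝ) 1, (meanAfter F 0 V / (1 + V) - c * (1 / (1 + V))) :=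
      setIntegral_congr_fun measurableSet_Ioo fun V hV => by
        simp only [hmean V (Set.Ioo_subset_Icc_self hV)]
        ring
    rw [e, integral_sub, integral_const_mul, setIntegral_one_div_one_add, hc]
    · field_simp
      ring
    · exact integrableOn_div_one_add (continuousOn_of_lipschitz (abs_meanAfter_sub_le hF 0))
    · exact (integrableOn_div_one_add continuousOn_const).const_mul c
  filter_upwards [ae_tendsto_birkhoffSum_div_of_mean_zero hG h0] with x hx
  have := hx.add_const c
  rw [zero_add] at this
  refine this.congr' ?_
  filter_upwards [eventually_ge_atTop 1] with n hn
  have hn0 : (n:ℝ) ≠ 0 := by positivity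
  simp only [birkhoffSum, Finset.sum_sub_distrib, Finset.sum_const, Finset.card_range,
    nsmul_eq_mul]
  field_simp
  ring

end LawOfLargeNumbers

/-- The approximation coefficient of a mediant, in terms of the future `u` and the past `w`. -/
noncomputable def mediantCoeff (u w : ℝ) : ℝ := u * w / (u + w)

/-- The observable `φ ∘ Θ` for the mediants with parameter `a`, extended by `0` to those points
whose leading digit is less than `a`. -/
noncomputable def mediantObs (a : ℕ) (φ : ℝ → ℝ) (p : ℝ × ℝ) : ℝ :=
  if (a : ℤ) ≤ ⌊1 / p.1⌋ then φ (mediantCoeff (a + gaussMap p.1) (⌊1 / p.1⌋ - a + p.2)) else 0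

section MediantObservable

lemma mediantCoeff_comm (u w : ℝ) : mediantCoeff u w = mediantCoeff w u := by
  rw [mediantCoeff, mediantCoeff, mul_comm, add_comm]

lemma abs_mediantCoeff_sub_le {u v w : ℝ} (hu : 0 ≤ u) (hv : 0 ≤ v) (hw : 0 ≤ w)
    (huw : 0 < u + w) (hvw : 0 < v + w) :
    |mediantCoeff u w - mediantCoeff v w| ≤ |u - v| := by
  have e : mediantCoeff u w - mediantCoeff v w = (u - v) * (w ^ 2 / ((u + w) * (v + w))) := by
    unfold mediantCoeff
    field_simp
    ring
  rw [e, abs_mul, abs_of_nonneg (by positivity : 0 ≤ w ^ 2 / ((u + w) * (v + w)))]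
  refine mul_le_of_le_one_right (abs_nonneg _) ?_
  rw [div_le_one (by positivity)]
  nlinarith [mul_nonneg hu hv, mul_nonneg hu hw, mul_nonneg hv hw]

variable {φ : ℝ → ℝ} {K : ℝ} {a : ℕ}

lemma mediantObs_gaussBranch (n : ℕ) {s : ℝ} (hs : s ∈ Set.Ioo (0:ℝ) 1) (V : ℝ) :
    mediantObs a φ (gaussBranch n s, V) =
      if a ≤ n + 1 then φ (mediantCoeff (a + s) (n + 1 - a + V)) else 0 := by
  have h : ((a : ℤ) ≤ (n : ℤ) + 1) = (a ≤ n + 1) := by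
    rw [eq_iff_iff]
    exact_mod_cast Iff.rfl
  simp only [mediantObs, floor_one_div_gaussBranch hs, gaussMap_gaussBranch hs, h]
  push_cast
  rfl

lemma branchLipschitz_mediantObs (ha : 1 ≤ a) (hφ : ∀ y, |φ y| ≤ 1)
    (hlip : ∀ y z, |φ y - φ z| ≤ K * |y - z|) : BranchLipschitz (mediantObs a φ) 1 K := by
  have hK : 0 ≤ K := by simpa using (abs_nonneg _).trans (hlip 1 0)
  have ha0 : (0:ℝ) < a := by exact_mod_cast ha
  have hφm : Measurable φ :=
    (LipschitzWith.of_dist_le_mul (K := ⟨K, hK⟩) fun y z => hlip y z).continuous.measurable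
  have hcast : ∀ N : ℤ, (a : ℤ) ≤ N → (0:ℝ) ≤ N - a := fun N hN => by
    have : ((a : ℤ) : ℝ) ≤ N := by exact_mod_cast hN
    push_cast at this
    linarith
  refine ⟨?_, fun p => ?_, fun n s hs s' hs' V hV => ?_, fun t ht V hV W hW => ?_⟩
  · unfold mediantObs mediantCoeff
    have h1 : Measurable fun p : ℝ × ℝ => (⌊1 / p.1⌋ : ℤ) :=
      Int.measurable_floor.comp (by fun_prop)
    have h2 : Measurable fun p : ℝ × ℝ => ((⌊1 / p.1⌋ : ℤ) : ℝ) :=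
      (measurable_from_top (f := fun n : ℤ => (n : ℝ))).comp h1
    have h3 : Measurable fun p : ℝ × ℝ => gaussMap p.1 := measurable_gaussMap.comp measurable_fst
    exact Measurable.ite (measurableSet_le measurable_const h1)
      (hφm.comp (by fun_prop)) measurable_const
  · unfold mediantObs
    split_ifs
    · exact hφ _
    · simp
  · rw [mediantObs_gaussBranch n hs, mediantObs_gaussBranch n hs']
    split_ifs with h
    · refine (hlip _ _).trans (mul_le_mul_of_nonneg_left ?_ hK)
      have h1 : (a:ℝ) ≤ n + 1 := by exact_mod_cast h
      have h2 := hs.1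
      have h3 := hs'.1
      have h4 := hV.1
      have e : s - s' = ((a:ℝ) + s) - (a + s') := by ring
      rw [e]
      apply abs_mediantCoeff_sub_le <;> linarith
    · simpa using mul_nonneg hK (abs_nonneg _)
  · unfold mediantObs
    dsimp only
    split_ifs with h
    · refine (hlip _ _).trans (mul_le_mul_of_nonneg_left ?_ hK)
      have h1 := hcast _ h
      have h2 : 0 ≤ gaussMap t := Int.fract_nonneg _
      have h3 := hV.1
      have h4 := hW.1
      have e : V - W = ((⌊1 / t⌋ : ℝ) - a + V) - (⌊1 / t⌋ - a + W) := by ring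
      rw [e, mediantCoeff_comm, mediantCoeff_comm (a + gaussMap t)]
      apply abs_mediantCoeff_sub_le <;> linarith
    · simpa using mul_nonneg hK (abs_nonneg _)

lemma integrable_div_one_add_mul_sq {F : ℝ × ℝ → ℝ} {B L : ℝ} (hF : BranchLipschitz F B L) :
    Integrable (fun p : ℝ × ℝ => F p / (1 + p.1 * p.2) ^ 2)
      ((volume.restrict (Set.Ioo 0 1)).prod (volume.restrict (Set.Ioo 0 1))) := by
  rw [Measure.prod_restrict]
  refine Measure.integrableOn_of_bounded (M := B) ?_
    (hF.measurable.div (by fun_prop)).aestronglyMeasurable ?_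
  · simp [Measure.prod_prod]
  · refine (ae_restrict_iff' (measurableSet_Ioo.prod measurableSet_Ioo)).2 (ae_of_all _ ?_)
    rintro ⟨t, V⟩ ⟨ht, hV⟩
    have hV0 : 0 < V := hV.1
    have ht0 : 0 < t := ht.1
    have h3 : 1 ≤ (1 + t * V) ^ 2 := one_le_pow₀ (by nlinarith)
    simp only [Real.norm_eq_abs, abs_div]
    rw [abs_of_nonneg (zero_le_one.trans h3)]
    exact (div_le_self (abs_nonneg _) h3).trans (hF.abs_le _)

lemma setIntegral_meanAfter_zero {F : ℝ × ℝ → ℝ} {B L : ℝ} (hF : BranchLipschitz F B L) :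
    ∫ V in Set.Ioo (0:ℝ) 1, meanAfter F 0 V / (1 + V) =
      ∫ t in Set.Ioo (0:ℝ) 1, ∫ V in Set.Ioo (0:ℝ) 1, F (t, V) / (1 + t * V) ^ 2 := by
  have h1 : ∫ V in Set.Ioo (0:ℝ) 1, meanAfter F 0 V / (1 + V) =
      ∫ V in Set.Ioo (0:ℝ) 1, ∫ t in Set.Ioo (0:ℝ) 1, F (t, V) / (1 + t * V) ^ 2 := by
    refine setIntegral_congr_fun measurableSet_Ioo fun V hV => ?_
    have hV0 := hV.1
    simp only [meanAfter, futureMean, ← integral_div]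
    refine setIntegral_congr_fun measurableSet_Ioo fun t ht => ?_
    have ht0 := ht.1
    simp only [futureDensity, Function.iterate_zero, id]
    field_simp
  rw [h1]
  exact (integral_integral_swap (f := fun t V => F (t, V) / (1 + t * V) ^ 2)
    (integrable_div_one_add_mul_sq hF)).symm

lemma hasDerivAt_mediantCoeff {u w : ℝ} (huw : 0 < u + w) :
    HasDerivAt (mediantCoeff u) (u ^ 2 / (u + w) ^ 2) w := by
  have h1 : HasDerivAt (fun w => u * w / (u + w)) ((u * 1 * (u + w) - u * w * 1) / (u + w) ^ 2) w :=
    ((hasDerivAt_id w).const_mul u).div ((hasDerivAt_id w).const_add u) huw.ne'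
  have e : u ^ 2 / (u + w) ^ 2 = (u * 1 * (u + w) - u * w * 1) / (u + w) ^ 2 := by ring
  rw [e]
  exact h1

lemma setIntegral_mediantCoeff (hφ : Continuous φ) {u : ℝ} (hu : 0 < u) (m : ℕ) :
    ∫ V in Set.Ioo (0:ℝ) 1, φ (mediantCoeff u (m + V)) / (u + m + V) ^ 2 =
      (∫ y in (0:ℝ)..mediantCoeff u (m + 1), φ y) / u ^ 2 -
        (∫ y in (0:ℝ)..mediantCoeff u m, φ y) / u ^ 2 := by
  have hm : (0:ℝ) ≤ m := m.cast_nonneg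
  rw [← integral_Ioc_eq_integral_Ioo, ← intervalIntegral.integral_of_le zero_le_one]
  have hd : ∀ V ∈ Set.uIcc (0:ℝ) 1,
      HasDerivAt (fun V => (∫ y in (0:ℝ)..mediantCoeff u (m + V), φ y) / u ^ 2)
        (φ (mediantCoeff u (m + V)) / (u + m + V) ^ 2) V := by
    intro V hV
    rw [Set.uIcc_of_le zero_le_one] at hV
    have hV0 := hV.1
    have h1 : HasDerivAt (fun V => mediantCoeff u (m + V)) (u ^ 2 / (u + (m + V)) ^ 2 * 1) V :=
      (hasDerivAt_mediantCoeff (by positivity)).comp V ((hasDerivAt_id V).const_add (m : ℝ))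
    have h2 : HasDerivAt (fun x => ∫ y in (0:ℝ)..x, φ y) (φ (mediantCoeff u (m + V)))
        (mediantCoeff u (m + V)) :=
      intervalIntegral.integral_hasDerivAt_right (hφ.intervalIntegrable _ _)
        (hφ.stronglyMeasurableAtFilter _ _) hφ.continuousAt
    have h3 := (h2.comp V h1).div_const (u ^ 2)
    have e : φ (mediantCoeff u (m + V)) / (u + m + V) ^ 2 =
        φ (mediantCoeff u (m + V)) * (u ^ 2 / (u + (m + V)) ^ 2 * 1) / u ^ 2 := by
      rw [← add_assoc]
      field_simp
    rw [e]
    exact h3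
  have hc : ContinuousOn (fun V : ℝ => φ (mediantCoeff u (m + V)) / (u + m + V) ^ 2)
      (Set.uIcc 0 1) := by
    rw [Set.uIcc_of_le zero_le_one]
    have hp : ∀ V ∈ Set.Icc (0:ℝ) 1, u + (m + V) ≠ 0 := fun V hV => by
      have := hV.1
      positivity
    unfold mediantCoeff
    refine ContinuousOn.div (hφ.comp_continuousOn (ContinuousOn.div (by fun_prop) (by fun_prop) hp))
      (by fun_prop) fun V hV => pow_ne_zero 2 ?_
    rw [add_assoc]
    exact hp V hV
  rw [intervalIntegral.integral_eq_sub_of_hasDerivAt hd hc.intervalIntegrable]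
  simp

lemma integrableOn_comp_add_div_sq {g : ℝ → ℝ} (hg : Continuous g) (ha : 1 ≤ a) :
    IntegrableOn (fun s : ℝ => g (a + s) / (a + s) ^ 2) (Set.Ioo 0 1) := by
  refine (ContinuousOn.integrableOn_Icc ?_).mono_set Set.Ioo_subset_Icc_self
  refine ContinuousOn.div (hg.comp_continuousOn (by fun_prop)) (by fun_prop)
    fun s hs => pow_ne_zero 2 ?_
  have := hs.1
  positivity

lemma setIntegral_mediantObs (ha : 1 ≤ a) (hφ : ∀ y, |φ y| ≤ 1)
    (hlip : ∀ y z, |φ y - φ z| ≤ K * |y - z|) :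
    ∫ V in Set.Ioo (0:ℝ) 1, meanAfter (mediantObs a φ) 0 V / (1 + V) =
      ∫ s in Set.Ioo (0:ℝ) 1, (∫ y in (0:ℝ)..a + s, φ y) / (a + s) ^ 2 := by
  have hK : 0 ≤ K := by simpa using (abs_nonneg _).trans (hlip 1 0)
  have hφc : Continuous φ :=
    (LipschitzWith.of_dist_le_mul (K := ⟨K, hK⟩) fun y z => hlip y z).continuous
  have hF := branchLipschitz_mediantObs ha hφ hlip
  obtain ⟨b, rfl⟩ := Nat.exists_eq_add_of_le' ha
  have hprim : Continuous fun y => ∫ x in (0:ℝ)..y, φ x :=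
    intervalIntegral.continuous_primitive (fun _ _ => hφc.intervalIntegrable _ _) 0
  have hcont : ∀ M : ℕ, IntegrableOn (fun s : ℝ =>
      (∫ y in (0:ℝ)..mediantCoeff ((b + 1 : ℕ) + s) M, φ y) / ((b + 1 : ℕ) + s) ^ 2)
      (Set.Ioo 0 1) := by
    intro M
    refine (ContinuousOn.integrableOn_Icc ?_).mono_set Set.Ioo_subset_Icc_self
    have hp : ∀ s ∈ Set.Icc (0:ℝ) 1, ((b + 1 : ℕ) : ℝ) + s ≠ 0 := fun s hs => by
      have := hs.1
      positivity
    unfold mediantCoeff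
    refine ContinuousOn.div (hprim.comp_continuousOn (ContinuousOn.div (by fun_prop) (by fun_prop)
      fun s hs => ?_)) (by fun_prop) fun s hs => pow_ne_zero 2 (hp s hs)
    have := hs.1
    positivity
  have hcont' := integrableOn_comp_add_div_sq hprim ha
  rw [setIntegral_meanAfter_zero hF]
  set f : ℕ → ℝ := fun n => ∫ s in Set.Ioo (0:ℝ) 1, gaussBranch n s ^ 2 *
    ∫ V in Set.Ioo (0:ℝ) 1, mediantObs (b + 1) φ (gaussBranch n s, V) /
      (1 + gaussBranch n s * V) ^ 2 with hf
  have hsum : HasSum f (∫ t in Set.Ioo (0:ℝ) 1, ∫ V in Set.Ioo (0:ℝ) 1,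
      mediantObs (b + 1) φ (t, V) / (1 + t * V) ^ 2) := by
    exact hasSum_setIntegral_gaussBranch (integrable_div_one_add_mul_sq hF).integral_prod_left
  have hterm : ∀ n s, s ∈ Set.Ioo (0:ℝ) 1 → gaussBranch n s ^ 2 *
      ∫ V in Set.Ioo (0:ℝ) 1, mediantObs (b + 1) φ (gaussBranch n s, V) /
        (1 + gaussBranch n s * V) ^ 2 = ∫ V in Set.Ioo (0:ℝ) 1,
        mediantObs (b + 1) φ (gaussBranch n s, V) / (n + 1 + s + V) ^ 2 := by
    intro n s hs
    rw [← integral_const_mul]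
    refine setIntegral_congr_fun measurableSet_Ioo fun V hV => ?_
    have := hs.1
    have := hV.1
    simp only [gaussBranch]
    field_simp
  have hpartial : ∀ M : ℕ, ∑ n ∈ Finset.range (b + M), f n = ∫ s in Set.Ioo (0:ℝ) 1,
      (∫ y in (0:ℝ)..mediantCoeff ((b + 1 : ℕ) + s) M, φ y) / ((b + 1 : ℕ) + s) ^ 2 := by
    intro M
    induction M with
    | zero =>
      simp only [mediantCoeff, Nat.cast_zero, mul_zero, zero_div, intervalIntegral.integral_same,
        integral_zero]
      refine Finset.sum_eq_zero fun n hn => ?_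
      have hn' : ¬ b + 1 ≤ n + 1 := by simpa using hn
      rw [hf]
      refine setIntegral_eq_zero_of_forall_eq_zero fun s hs => ?_
      simp [mediantObs_gaussBranch n hs, hn']
    | succ M ih =>
      rw [← add_assoc, Finset.sum_range_succ, ih, eq_comm, ← sub_eq_iff_eq_add',
        ← integral_sub (hcont (M + 1)) (hcont M), hf]
      refine setIntegral_congr_fun measurableSet_Ioo fun s hs => ?_
      have hs0 := hs.1
      rw [hterm _ s hs, Nat.cast_succ M, ← setIntegral_mediantCoeff hφc (by positivity)]
      refine setIntegral_congr_fun measurableSet_Ioo fun V hV => ?_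
      simp only [mediantObs_gaussBranch _ hs]
      rw [if_pos (by omega)]
      push_cast
      congr 2
      · congr 1
        ring
      · ring
  have hlim : Tendsto (fun M : ℕ => ∑ n ∈ Finset.range (b + M), f n) atTop
      (𝓝 (∫ s in Set.Ioo (0:ℝ) 1, (∫ y in (0:ℝ)..(b + 1 : ℕ) + s, φ y) / ((b + 1 : ℕ) + s) ^ 2)) := by
    simp only [hpartial]
    rw [tendsto_iff_norm_sub_tendsto_zero]
    refine squeeze_zero (fun _ => norm_nonneg _) (fun M => ?_)
      (tendsto_one_div_add_atTop_nhds_zero_nat (𝕜 := ℝ))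
    rw [← integral_sub (hcont M) hcont']
    refine (norm_setIntegral_le_of_norm_le_const (C := 1 / ((M:ℝ) + 1)) (by simp)
      fun s hs => ?_).trans (by simp)
    have hs0 := hs.1
    have hM : (0:ℝ) ≤ M := M.cast_nonneg
    have hb : (0:ℝ) ≤ b := b.cast_nonneg
    rw [← sub_div, intervalIntegral.integral_interval_sub_left (hφc.intervalIntegrable _ _)
      (hφc.intervalIntegrable _ _), norm_div, Real.norm_of_nonneg (sq_nonneg (_ : ℝ)),
      div_le_iff₀ (by positivity)]
    refine (intervalIntegral.norm_integral_le_of_norm_le_const (C := 1) fun y _ => hφ y).trans ?_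
    have e : mediantCoeff ((b + 1 : ℕ) + s) M - ((b + 1 : ℕ) + s) =
        -(((b + 1 : ℕ) + s) ^ 2 / ((b + 1 : ℕ) + s + M)) := by
      unfold mediantCoeff
      field_simp
      ring
    rw [e, abs_neg, abs_of_nonneg (by positivity), one_mul, div_eq_mul_one_div, mul_comm]
    refine mul_le_mul_of_nonneg_right ?_ (by positivity)
    refine one_div_le_one_div_of_le (by positivity) ?_
    push_cast
    linarith
  have hlim' := hsum.tendsto_sum_nat.comp (tendsto_add_atTop_nat b)
  refine tendsto_nhds_unique hlim' (hlim.congr fun M => ?_)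
  rw [Function.comp_apply, add_comm]

end MediantObservable

/-- The mass, for the invariant measure times `log 2`, of the points with leading digit at least
`a` whose mediant has approximation coefficient at most `z`. -/
noncomputable def limitMass (a : ℕ) (z : ℝ) : ℝ :=
  ∫ s in Set.Ioo (0:ℝ) 1, min (a + s) z / (a + s) ^ 2

/-- The piecewise linear function equal to `1` up to `p` and to `0` from `q` on. -/
noncomputable def ramp (p q y : ℝ) : ℝ := max 0 (min 1 ((q - y) / (q - p)))

section LimitMass

lemma ramp_nonneg (p q y : ℝ) : 0 ≤ ramp p q y := le_max_left _ _

lemma ramp_le_one (p q y : ℝ) : ramp p q y ≤ 1 := max_le zero_le_one (min_le_left _ _)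

variable {p q y z ε u : ℝ} {a : ℕ}

lemma ramp_eq_one (hpq : p < q) (hy : y ≤ p) : ramp p q y = 1 := by
  have h : 1 ≤ (q - y) / (q - p) := by
    rw [le_div_iff₀ (by linarith)]
    linarith
  rw [ramp, min_eq_left h, max_eq_right zero_le_one]

lemma ramp_eq_zero (hpq : p < q) (hy : q ≤ y) : ramp p q y = 0 := by
  have h : (q - y) / (q - p) ≤ 0 := div_nonpos_of_nonpos_of_nonneg (by linarith) (by linarith)
  rw [ramp, max_eq_left ((min_le_right _ _).trans h)]

lemma abs_ramp_le_one (p q y : ℝ) : |ramp p q y| ≤ 1 := by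
  rw [abs_of_nonneg (ramp_nonneg p q y)]
  exact ramp_le_one p q y

lemma abs_ramp_sub_le (hpq : p < q) (y z : ℝ) :
    |ramp p q y - ramp p q z| ≤ 1 / (q - p) * |y - z| := by
  unfold ramp
  refine (abs_max_sub_max_le_max _ _ _ _).trans ?_
  have h1 := abs_min_sub_min_le_max 1 ((q - y) / (q - p)) 1 ((q - z) / (q - p))
  have h2 : |(q - y) / (q - p) - (q - z) / (q - p)| = 1 / (q - p) * |y - z| := by
    have e : (q - y) / (q - p) - (q - z) / (q - p) = 1 / (q - p) * (z - y) := by ring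
    rw [e, abs_mul, abs_of_pos (one_div_pos.2 (sub_pos.2 hpq)), abs_sub_comm]
  rw [h2] at h1
  have h3 : 0 ≤ 1 / (q - p) * |y - z| := by
    have := sub_pos.2 hpq
    positivity
  simp only [sub_self, abs_zero] at h1 ⊢
  rw [max_eq_right h3] at h1
  exact max_le h3 h1

lemma continuous_ramp (p q : ℝ) : Continuous (ramp p q) := by
  unfold ramp
  fun_prop

lemma intervalIntegrable_ramp (p q c d : ℝ) : IntervalIntegrable (ramp p q) volume c d :=
  (continuous_ramp p q).intervalIntegrable _ _

lemma min_le_integral_ramp (hpq : p < q) (hu : 0 ≤ u) :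
    min u p ≤ ∫ y in (0:ℝ)..u, ramp p q y := by
  set r := min u (max p 0) with hr
  have hr0 : 0 ≤ r := le_min hu (le_max_right _ _)
  have hru : r ≤ u := min_le_left _ _
  have h1 : ∫ y in (0:ℝ)..r, (1:ℝ) ≤ ∫ y in (0:ℝ)..r, ramp p q y := by
    refine intervalIntegral.integral_mono_on_of_le_Ioo hr0 (by simp)
      (intervalIntegrable_ramp p q _ _) fun y hy => ?_
    have h2 : y < max p 0 := hy.2.trans_le (min_le_right _ _)
    rw [ramp_eq_one hpq]
    rcases lt_max_iff.1 h2 with h | h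
    · exact h.le
    · exact absurd hy.1 h.not_gt
  have h2 : 0 ≤ ∫ y in r..u, ramp p q y :=
    intervalIntegral.integral_nonneg hru fun y _ => ramp_nonneg p q y
  rw [← intervalIntegral.integral_add_adjacent_intervals (intervalIntegrable_ramp p q 0 r)
    (intervalIntegrable_ramp p q r u)]
  have h3 : min u p ≤ r := min_le_min le_rfl (le_max_left _ _)
  simp only [intervalIntegral.integral_const, smul_eq_mul, mul_one, sub_zero] at h1
  linarith

lemma integral_ramp_le_min (hpq : p < q) (hu : 0 ≤ u) :
    ∫ y in (0:ℝ)..u, ramp p q y ≤ min u (max q 0) := by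
  set r := min u (max q 0) with hr
  have hr0 : 0 ≤ r := le_min hu (le_max_right _ _)
  have hru : r ≤ u := min_le_left _ _
  have h1 : ∫ y in (0:ℝ)..r, ramp p q y ≤ ∫ y in (0:ℝ)..r, (1:ℝ) :=
    intervalIntegral.integral_mono_on hr0 (intervalIntegrable_ramp p q _ _) (by simp)
      fun y _ => ramp_le_one p q y
  have h2 : ∫ y in r..u, ramp p q y ≤ ∫ y in r..u, (0:ℝ) := by
    refine intervalIntegral.integral_mono_on_of_le_Ioo hru (intervalIntegrable_ramp p q _ _)
      (by simp) fun y hy => ?_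
    have h3 : max q 0 ≤ y := by
      rcases min_lt_iff.1 hy.1 with h | h
      · exact absurd hy.2 h.not_gt
      · exact h.le
    rw [ramp_eq_zero hpq ((le_max_left _ _).trans h3)]
  rw [← intervalIntegral.integral_add_adjacent_intervals (intervalIntegrable_ramp p q 0 r)
    (intervalIntegrable_ramp p q r u)]
  simp only [intervalIntegral.integral_const, smul_eq_mul, mul_one, sub_zero, mul_zero] at h1 h2
  linarith

lemma one_le_natCast_add_sq (ha : 1 ≤ a) {s : ℝ} (hs : s ∈ Set.Ioo (0:ℝ) 1) :
    1 ≤ ((a:ℝ) + s) ^ 2 := by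
  have h1 : (1:ℝ) ≤ a := by exact_mod_cast ha
  exact one_le_pow₀ (by linarith [hs.1])

lemma continuous_integral_ramp (p q : ℝ) : Continuous fun u => ∫ y in (0:ℝ)..u, ramp p q y :=
  intervalIntegral.continuous_primitive (fun _ _ => intervalIntegrable_ramp p q _ _) 0

lemma setIntegral_ramp_le (ha : 1 ≤ a) (hpq : p < q) (hε : 0 ≤ ε) (hz : 0 ≤ z) (hq : q ≤ z + ε) :
    ∫ s in Set.Ioo (0:ℝ) 1, (∫ y in (0:ℝ)..a + s, ramp p q y) / (a + s) ^ 2 ≤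
      limitMass a z + ε := by
  have hi := integrableOn_comp_add_div_sq (g := fun u => min u z) (by fun_prop) ha
  have e : limitMass a z + ε = ∫ s in Set.Ioo (0:ℝ) 1, (min (a + s) z / (a + s) ^ 2 + ε) := by
    rw [integral_add hi (by simp)]
    simp [limitMass]
  rw [e]
  refine setIntegral_mono_on (integrableOn_comp_add_div_sq (continuous_integral_ramp p q) ha)
    (hi.add (by simp)) measurableSet_Ioo fun s hs => ?_
  have h1 := one_le_natCast_add_sq ha hs
  have h2 : (0:ℝ) ≤ a + s := add_nonneg a.cast_nonneg hs.1.le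
  have h3 := integral_ramp_le_min hpq h2
  have h4 : min ((a:ℝ) + s) (max q 0) ≤ min ((a:ℝ) + s) z + ε := by
    rw [← min_add_add_right]
    exact min_le_min (by linarith) (max_le hq (by linarith))
  rw [div_add' _ _ _ (by positivity)]
  refine div_le_div_of_nonneg_right ?_ (by positivity)
  have := mul_le_mul_of_nonneg_left h1 hε
  linarith

lemma le_setIntegral_ramp (ha : 1 ≤ a) (hpq : p < q) (hε : 0 ≤ ε) (hp : z ≤ p + ε) :
    limitMass a z ≤
      (∫ s in Set.Ioo (0:ℝ) 1, (∫ y in (0:ℝ)..a + s, ramp p q y) / (a + s) ^ 2) + ε := by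
  have hi := integrableOn_comp_add_div_sq (continuous_integral_ramp p q) ha
  have e : (∫ s in Set.Ioo (0:ℝ) 1, (∫ y in (0:ℝ)..a + s, ramp p q y) / (a + s) ^ 2) + ε =
      ∫ s in Set.Ioo (0:ℝ) 1, ((∫ y in (0:ℝ)..a + s, ramp p q y) / (a + s) ^ 2 + ε) := by
    rw [integral_add hi (by simp)]
    simp
  rw [e, limitMass]
  refine setIntegral_mono_on
    (integrableOn_comp_add_div_sq (g := fun u => min u z) (by fun_prop) ha)
    (hi.add (by simp)) measurableSet_Ioo fun s hs => ?_
  have h1 := one_le_natCast_add_sq ha hs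
  have h2 : (0:ℝ) ≤ a + s := add_nonneg a.cast_nonneg hs.1.le
  have h3 := min_le_integral_ramp hpq h2
  have h4 : min ((a:ℝ) + s) z ≤ min ((a:ℝ) + s) p + ε := by
    rw [← min_add_add_right]
    exact min_le_min (by linarith) hp
  rw [div_add' _ _ _ (by positivity)]
  refine div_le_div_of_nonneg_right ?_ (by positivity)
  have := mul_le_mul_of_nonneg_left h1 hε
  linarith

lemma integral_one_div_sq {c d : ℝ} (hc : 0 < c) (hcd : c ≤ d) :
    ∫ u in c..d, 1 / u ^ 2 = 1 / c - 1 / d := by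
  have hpos : ∀ u ∈ Set.uIcc c d, u ≠ 0 := fun u hu => by
    rw [Set.uIcc_of_le hcd] at hu
    exact (hc.trans_le hu.1).ne'
  rw [intervalIntegral.integral_eq_sub_of_hasDerivAt (f := fun u => -(1 / u))]
  · ring
  · intro u hu
    have h : HasDerivAt (fun u : ℝ => -u⁻¹) (-(-(u ^ 2)⁻¹)) u := (hasDerivAt_inv (hpos u hu)).neg
    simpa [one_div] using h
  · exact (ContinuousOn.div continuousOn_const (by fun_prop)
      fun u hu => pow_ne_zero 2 (hpos u hu)).intervalIntegrable

lemma limitMass_eq_intervalIntegral (a : ℕ) (z : ℝ) :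
    limitMass a z = ∫ u in (a:ℝ)..a + 1, min u z / u ^ 2 := by
  rw [limitMass, ← integral_Ioc_eq_integral_Ioo, ← intervalIntegral.integral_of_le zero_le_one,
    intervalIntegral.integral_comp_add_left (fun u => min u z / u ^ 2) (a:ℝ), add_zero]

lemma limitMass_eq (ha : 1 ≤ a) (hz : z ≤ a + 1) :
    limitMass a z = if z ≤ a then z / (a * (a + 1)) else 1 - z / (a + 1) + Real.log (z / a) := by
  have ha0 : (0:ℝ) < a := by exact_mod_cast ha
  have hconst : ∀ c : ℝ, 0 < c → c ≤ a + 1 → z ≤ c →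
      ∫ u in c..a + 1, min u z / u ^ 2 = z * (1 / c - 1 / (a + 1)) := by
    intro c hc0 hc hzc
    rw [← integral_one_div_sq hc0 hc, ← intervalIntegral.integral_const_mul]
    refine intervalIntegral.integral_congr fun u hu => ?_
    rw [Set.uIcc_of_le hc] at hu
    simp only [min_eq_right (hzc.trans hu.1)]
    ring
  rw [limitMass_eq_intervalIntegral]
  split_ifs with h
  · rw [hconst a ha0 (by linarith) h]
    field_simp
    ring
  · have haz : (a:ℝ) ≤ z := (not_le.1 h).le
    have hz0 : 0 < z := ha0.trans_le haz
    have hi : ∀ c d : ℝ, 0 < c → c ≤ d →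
        IntervalIntegrable (fun u => min u z / u ^ 2) volume c d := by
      intro c d hc hcd
      refine (ContinuousOn.div (by fun_prop) (by fun_prop) fun u hu => ?_).intervalIntegrable
      rw [Set.uIcc_of_le hcd] at hu
      exact pow_ne_zero 2 (hc.trans_le hu.1).ne'
    rw [← intervalIntegral.integral_add_adjacent_intervals (hi a z ha0 haz) (hi z (a + 1) hz0 hz),
      hconst z hz0 hz le_rfl]
    have h1 : ∫ u in (a:ℝ)..z, min u z / u ^ 2 = ∫ u in (a:ℝ)..z, 1 / u := by
      refine intervalIntegral.integral_congr fun u hu => ?_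
      rw [Set.uIcc_of_le haz] at hu
      have hu0 : 0 < u := ha0.trans_le hu.1
      simp only [min_eq_left hu.2]
      field_simp
    rw [h1, integral_one_div_of_pos ha0 hz0]
    field_simp
    ring

lemma limitMass_natCast_add_one (ha : 1 ≤ a) :
    limitMass a (a + 1) = Real.log (((a:ℝ) + 1) / a) := by
  have h : (a:ℝ) + 1 ≠ 0 := by positivity
  rw [limitMass_eq ha le_rfl, if_neg (by linarith), div_self h]
  ring

lemma dist8_eq (ha : 1 ≤ a) (hz : z ≤ a + 1) :
    dist8 a z = limitMass a z / limitMass a (a + 1) := by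
  rw [limitMass_natCast_add_one ha, limitMass_eq ha hz, dist8]
  ring

end LimitMass

section Convergents

variable {x : ℝ}

lemma gaussMap_iterate_mem (hx : x ∈ Set.Ioo (0:ℝ) 1) (hirr : Irrational x) (j : ℕ) :
    gaussMap^[j] x ∈ Set.Ioo (0:ℝ) 1 ∧ Irrational (gaussMap^[j] x) := by
  induction j with
  | zero => exact ⟨hx, hirr⟩
  | succ j ih =>
    rw [Function.iterate_succ_apply']
    generalize gaussMap^[j] x = t at ih
    have hirr' : Irrational (gaussMap t) := by
      unfold gaussMap Int.fract
      rw [one_div]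
      exact ih.2.inv.sub_intCast _
    exact ⟨⟨lt_of_le_of_ne (Int.fract_nonneg _) hirr'.ne_zero.symm, Int.fract_lt_one _⟩, hirr'⟩

lemma one_div_gaussMap_iterate (x : ℝ) (j : ℕ) :
    1 / gaussMap^[j] x = pquot x j + gaussMap^[j + 1] x := by
  rw [Function.iterate_succ_apply', pquot, gaussMap, Int.floor_add_fract]

lemma one_le_pquot (hx : x ∈ Set.Ioo (0:ℝ) 1) (hirr : Irrational x) (j : ℕ) : 1 ≤ pquot x j := by
  obtain ⟨⟨h0, h1⟩, -⟩ := gaussMap_iterate_mem hx hirr j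
  rw [pquot, Int.le_floor, Int.cast_one, le_div_iff₀ h0]
  linarith

lemma qden_nonneg_and_pos (hx : x ∈ Set.Ioo (0:ℝ) 1) (hirr : Irrational x) (j : ℕ) :
    0 ≤ qden x j ∧ 0 < qden x (j + 1) := by
  induction j with
  | zero => simp [qden]
  | succ j ih =>
    refine ⟨ih.2.le, ?_⟩
    rw [qden]
    have := one_le_pquot hx hirr j
    have := mul_pos (zero_lt_one.trans_le this) ih.2
    linarith [ih.1]

lemma gaussNE_iterate (hx : x ∈ Set.Ioo (0:ℝ) 1) (hirr : Irrational x) (j : ℕ) :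
    gaussNE^[j] (x, 0) = (gaussMap^[j] x, (qden x j : ℝ) / qden x (j + 1)) := by
  induction j with
  | zero => simp [qden]
  | succ j ih =>
    have hq : (0:ℝ) < qden x (j + 1) := by exact_mod_cast (qden_nonneg_and_pos hx hirr j).2
    rw [Function.iterate_succ_apply', ih, gaussNE, Function.iterate_succ_apply' gaussMap]
    refine Prod.ext rfl ?_
    simp only [qden]
    rw [← pquot]
    push_cast
    rw [add_div' _ _ _ hq.ne', one_div_div]

lemma qden_mul_sub_pnum_succ (hx : x ∈ Set.Ioo (0:ℝ) 1) (hirr : Irrational x) (j : ℕ) :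
    (qden x (j + 1) * x - pnum x (j + 1) : ℝ) =
      -gaussMap^[j] x * (qden x j * x - pnum x j) := by
  induction j with
  | zero => simp [qden, pnum]
  | succ j ih =>
    have ht := (gaussMap_iterate_mem hx hirr j).1.1
    have h : gaussMap^[j + 1] x = 1 / gaussMap^[j] x - pquot x j := by
      rw [one_div_gaussMap_iterate]
      ring
    simp only [qden, pnum]
    push_cast
    have e : (qden x j * x - pnum x j : ℝ) =
        -(1 / gaussMap^[j] x) * (qden x (j + 1) * x - pnum x (j + 1)) := by
      rw [ih]
      field_simp
    rw [h]
    linear_combination e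

lemma abs_qden_mul_sub_pnum (hx : x ∈ Set.Ioo (0:ℝ) 1) (hirr : Irrational x) (j : ℕ) :
    |(qden x j * x - pnum x j : ℝ)| * (qden x (j + 1) + gaussMap^[j] x * qden x j) = 1 := by
  induction j with
  | zero => simp [qden, pnum]
  | succ j ih =>
    have ht := (gaussMap_iterate_mem hx hirr j).1.1
    have h := one_div_gaussMap_iterate x j
    rw [← ih, qden_mul_sub_pnum_succ hx hirr, abs_mul, abs_neg, abs_of_pos ht]
    have e : (qden x (j + 1 + 1) + gaussMap^[j + 1] x * qden x (j + 1) : ℝ) =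
        1 / gaussMap^[j] x * qden x (j + 1) + qden x j := by
      rw [h]
      simp only [qden]
      push_cast
      ring
    rw [e]
    field_simp

/-- The approximation coefficient of a mediant, in terms of the natural extension. -/
lemma medTheta_eq_mediantCoeff (hx : x ∈ Set.Ioo (0:ℝ) 1) (hirr : Irrational x) {a j : ℕ}
    (ha : 1 ≤ a) (hj : (a : ℤ) ≤ pquot x j) : medTheta x (pquot x j - a) j =
      mediantCoeff (a + gaussMap^[j + 1] x)
        (pquot x j - a + (qden x j : ℝ) / qden x (j + 1)) := by
  have ha0 : (0:ℝ) < a := by exact_mod_cast ha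
  have ht := (gaussMap_iterate_mem hx hirr j).1.1
  have ht' := (gaussMap_iterate_mem hx hirr (j + 1)).1.1
  have hq : (0:ℝ) ≤ qden x j := by exact_mod_cast (qden_nonneg_and_pos hx hirr j).1
  have hq' : (0:ℝ) < qden x (j + 1) := by exact_mod_cast (qden_nonneg_and_pos hx hirr j).2
  have hl : (0:ℝ) ≤ pquot x j - a := by
    have : ((a : ℤ) : ℝ) ≤ pquot x j := by exact_mod_cast hj
    push_cast at this
    linarith
  have h := one_div_gaussMap_iterate x j
  have hdet := abs_qden_mul_sub_pnum hx hirr j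
  have hN : (pquot x j : ℝ) = 1 / gaussMap^[j] x - gaussMap^[j + 1] x := by linarith
  have herr : |((pquot x j - a : ℝ) * qden x (j + 1) + qden x j) * x -
      ((pquot x j - a : ℝ) * pnum x (j + 1) + pnum x j)| =
      |(qden x j * x - pnum x j : ℝ)| * (gaussMap^[j] x * (a + gaussMap^[j + 1] x)) := by
    have e : ((pquot x j - a : ℝ) * qden x (j + 1) + qden x j) * x -
        ((pquot x j - a : ℝ) * pnum x (j + 1) + pnum x j) =
        (qden x j * x - pnum x j : ℝ) * (gaussMap^[j] x * (a + gaussMap^[j + 1] x)) := by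
      have e1 := qden_mul_sub_pnum_succ hx hirr j
      have e2 : 1 - (pquot x j - a : ℝ) * gaussMap^[j] x =
          gaussMap^[j] x * (a + gaussMap^[j + 1] x) := by
        rw [hN]
        field_simp
        ring
      rw [← e2]
      linear_combination (pquot x j - a : ℝ) * e1
    rw [e, abs_mul, abs_of_pos (by positivity : 0 < gaussMap^[j] x * (a + gaussMap^[j + 1] x))]
  have hsum : (0:ℝ) < qden x (j + 1) + gaussMap^[j] x * qden x j := by positivity
  rw [← eq_div_iff hsum.ne'] at hdet
  rw [medTheta, Theta]
  push_cast
  rw [herr, hdet, mediantCoeff]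
  have huw : (a + gaussMap^[j + 1] x + (pquot x j - a + (qden x j : ℝ) / qden x (j + 1))) =
      (qden x (j + 1) + gaussMap^[j] x * qden x j) / (gaussMap^[j] x * qden x (j + 1)) := by
    rw [hN]
    field_simp
    ring
  rw [huw]
  field_simp

lemma medTheta_pos_and_lt (hx : x ∈ Set.Ioo (0:ℝ) 1) (hirr : Irrational x) {a j : ℕ}
    (ha : 1 ≤ a) (hj : (a : ℤ) ≤ pquot x j) :
    (¬(j = 0 ∧ pquot x j = a) → 0 < medTheta x (pquot x j - a) j) ∧
      medTheta x (pquot x j - a) j < a + 1 := by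
  rw [medTheta_eq_mediantCoeff hx hirr ha hj, mediantCoeff]
  have ha0 : (0:ℝ) < a := by exact_mod_cast ha
  obtain ⟨ht0, ht1⟩ := (gaussMap_iterate_mem hx hirr (j + 1)).1
  have hq : (0:ℝ) ≤ qden x j := by exact_mod_cast (qden_nonneg_and_pos hx hirr j).1
  have hq' : (0:ℝ) < qden x (j + 1) := by exact_mod_cast (qden_nonneg_and_pos hx hirr j).2
  have hl : (0:ℝ) ≤ pquot x j - a := by
    have : ((a : ℤ) : ℝ) ≤ pquot x j := by exact_mod_cast hj
    push_cast at this
    linarith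
  have hV : 0 ≤ (qden x j : ℝ) / qden x (j + 1) := by positivity
  constructor
  · intro hdeg
    have hw : 0 < (pquot x j - a : ℝ) + (qden x j : ℝ) / qden x (j + 1) := by
      rcases j with - | j
      · have h1 : (a : ℤ) < pquot x 0 := lt_of_le_of_ne hj fun h => hdeg ⟨rfl, h.symm⟩
        have h2 : ((a : ℤ) : ℝ) < pquot x 0 := by exact_mod_cast h1
        push_cast at h2
        linarith
      · have h1 : (0:ℝ) < qden x (j + 1) := by exact_mod_cast (qden_nonneg_and_pos hx hirr j).2
        positivity
    positivity
  · rw [div_lt_iff₀ (by positivity)]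
    nlinarith

lemma mediantObs_gaussNE_iterate (hx : x ∈ Set.Ioo (0:ℝ) 1) (hirr : Irrational x) {a : ℕ}
    (ha : 1 ≤ a) (φ : ℝ → ℝ) (j : ℕ) : mediantObs a φ (gaussNE^[j] (x, 0)) =
      if (a : ℤ) ≤ pquot x j then φ (medTheta x (pquot x j - a) j) else 0 := by
  rw [gaussNE_iterate hx hirr, mediantObs]
  dsimp only
  rw [← pquot]
  split_ifs with h
  · rw [medTheta_eq_mediantCoeff hx hirr ha h, Function.iterate_succ_apply']
  · rfl

end Convergents

section Counting

/-- Relative frequencies along the increasing enumeration of a set of positive density. -/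
lemma infinite_and_tendsto_card_filter_nth {P Q : ℕ → Prop} [DecidablePred P] [DecidablePred Q]
    {α β : ℝ} (hα : 0 < α)
    (hP : Tendsto (fun n : ℕ => (((Finset.range n).filter P).card : ℝ) / n) atTop (𝓝 α))
    (hQ : Tendsto (fun n : ℕ => (((Finset.range n).filter fun j => P j ∧ Q j).card : ℝ) / n) atTop
      (𝓝 β)) :
    {j | P j}.Infinite ∧
      Tendsto (fun n : ℕ => (((Finset.range n).filter fun k => Q (Nat.nth P k)).card : ℝ) / n) atTop
        (𝓝 (β / α)) := by
  have hinf : {j | P j}.Infinite := by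
    intro hfin
    have h0 : Tendsto (fun n : ℕ => (((Finset.range n).filter P).card : ℝ) / n) atTop (𝓝 0) := by
      refine squeeze_zero (fun n => by positivity) (fun n => ?_)
        (tendsto_const_div_atTop_nhds_zero_nat (hfin.toFinset.card : ℝ))
      refine div_le_div_of_nonneg_right ?_ n.cast_nonneg
      exact_mod_cast Finset.card_le_card fun j hj => by simpa using (Finset.mem_filter.1 hj).2
    exact hα.ne' (tendsto_nhds_unique hP h0)
  refine ⟨hinf, ?_⟩
  have hmono := Nat.nth_strictMono hinf
  have hcount : ∀ n, ((Finset.range n).filter fun k => Q (Nat.nth P k)).card =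
      ((Finset.range (Nat.nth P n)).filter fun j => P j ∧ Q j).card := by
    intro n
    refine Finset.card_nbij' (Nat.nth P) (Nat.count P) ?_ ?_ ?_ ?_
    · intro k hk
      simp only [Finset.coe_filter, Finset.mem_range, Set.mem_ofPred_eq] at hk ⊢
      exact ⟨hmono hk.1, Nat.nth_mem_of_infinite hinf k, hk.2⟩
    · intro j hj
      simp only [Finset.coe_filter, Finset.mem_range, Set.mem_ofPred_eq] at hj ⊢
      rw [Nat.nth_count hj.2.1]
      refine ⟨?_, hj.2.2⟩
      rw [← hmono.lt_iff_lt, Nat.nth_count hj.2.1]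
      exact hj.1
    · intro k _
      exact Nat.count_nth_of_infinite hinf k
    · intro j hj
      simp only [Finset.coe_filter, Finset.mem_range, Set.mem_ofPred_eq] at hj
      exact Nat.nth_count hj.2.1
  have hn : ∀ n, ((Finset.range (Nat.nth P n)).filter P).card = n := fun n => by
    rw [← Nat.count_eq_card_filter_range, Nat.count_nth_of_infinite hinf]
  have hlim := (hQ.div hP hα.ne').comp hmono.tendsto_atTop
  refine hlim.congr' ?_
  filter_upwards [eventually_ge_atTop 1] with n h1
  have h2 : ((Nat.nth P n : ℕ) : ℝ) ≠ 0 := by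
    exact_mod_cast (zero_lt_one.trans_le (h1.trans hmono.le_apply)).ne'
  simp only [Function.comp_apply, Pi.div_apply]
  rw [div_div_div_cancel_right₀ h2, hcount, hn]

variable {x : ℝ} {a : ℕ}

/-- Limiting frequency of the mediants with approximation coefficient at most `z`, deduced from
the averages of ramp functions. -/
lemma tendsto_card_filter_medTheta (hx : x ∈ Set.Ioo (0:ℝ) 1) (hirr : Irrational x) (ha : 1 ≤ a)
    (havg : ∀ p q : ℚ, p < q → Tendsto
      (fun n : ℕ => birkhoffSum gaussNE (mediantObs a (ramp p q)) n (x, 0) / n) atTop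
      (𝓝 ((∫ s in Set.Ioo (0:ℝ) 1, (∫ y in (0:ℝ)..a + s, ramp p q y) / (a + s) ^ 2) /
        Real.log 2))) {z : ℝ} (hz : 0 ≤ z) :
    Tendsto (fun n : ℕ => (((Finset.range n).filter fun j =>
      (a : ℤ) ≤ pquot x j ∧ medTheta x (pquot x j - a) j ≤ z).card : ℝ) / n) atTop
      (𝓝 (limitMass a z / Real.log 2)) := by
  have hlog := Real.log_pos one_lt_two
  have hsum : ∀ φ n, birkhoffSum gaussNE (mediantObs a φ) n (x, 0) =
      ∑ j ∈ Finset.range n, if (a : ℤ) ≤ pquot x j then φ (medTheta x (pquot x j - a) j) else 0 :=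
    fun φ n => Finset.sum_congr rfl fun j _ => mediantObs_gaussNE_iterate hx hirr ha φ j
  have hcard : ∀ n, (((Finset.range n).filter fun j =>
      (a : ℤ) ≤ pquot x j ∧ medTheta x (pquot x j - a) j ≤ z).card : ℝ) =
      ∑ j ∈ Finset.range n,
        if (a : ℤ) ≤ pquot x j ∧ medTheta x (pquot x j - a) j ≤ z then 1 else 0 := fun n => by
    rw [Finset.card_filter]
    push_cast
    rfl
  refine tendsto_order.2 ⟨fun b hb => ?_, fun b hb => ?_⟩
  · rw [lt_div_iff₀ hlog] at hb
    obtain ⟨p, hp1, hp2⟩ := exists_rat_btwn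
      (by linarith : z - (limitMass a z - b * Real.log 2) < z)
    obtain ⟨q, hq1, hq2⟩ := exists_rat_btwn hp2
    have hpq : p < q := by exact_mod_cast hq1
    have hJ := le_setIntegral_ramp (z := z) (ε := z - p) ha hq1 (by linarith) (by linarith)
    filter_upwards [(havg p q hpq).eventually_const_lt
      ((lt_div_iff₀ hlog).2 (by linarith : b * Real.log 2 < _))] with n hn
    refine hn.trans_le (div_le_div_of_nonneg_right ?_ n.cast_nonneg)
    rw [hsum, hcard]
    refine Finset.sum_le_sum fun j _ => ?_
    split_ifs with h1 h2 h2
    · exact ramp_le_one _ _ _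
    · rw [ramp_eq_zero hq1]
      exact hq2.le.trans (not_le.1 fun h => h2 ⟨h1, h⟩).le
    · exact zero_le_one
    · exact le_rfl
  · rw [gt_iff_lt, div_lt_iff₀ hlog] at hb
    obtain ⟨q, hq1, hq2⟩ := exists_rat_btwn
      (by linarith : z < z + (b * Real.log 2 - limitMass a z))
    obtain ⟨p, hp1, hp2⟩ := exists_rat_btwn hq1
    have hpq : p < q := by exact_mod_cast hp2
    have hJ := setIntegral_ramp_le (z := z) (ε := q - z) ha hp2 (by linarith) hz (by linarith)
    filter_upwards [(havg p q hpq).eventually_lt_const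
      ((div_lt_iff₀ hlog).2 (by linarith : _ < b * Real.log 2))] with n hn
    refine (div_le_div_of_nonneg_right ?_ n.cast_nonneg).trans_lt hn
    rw [hsum, hcard]
    refine Finset.sum_le_sum fun j _ => ?_
    split_ifs with h1 h2 h2
    · rw [ramp_eq_one hp2 (h1.2.trans hp1.le)]
    · exact absurd h1.1 h2
    · exact ramp_nonneg _ _ _
    · exact le_rfl

end Counting

/-- Bounds and limiting distribution for the approximation coefficients of the mediants
`((a_{j+1} − a) p_j + p_{j−1})/((a_{j+1} − a) q_j + q_{j−1})`, `a_{j+1} ≥ a`. -/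
theorem stmt_8 (a : ℕ) (ha : 1 ≤ a) :
    (∀ x : ℝ, x ∈ Set.Ioo (0:ℝ) 1 → Irrational x → ∀ j : ℕ, (a : ℤ) ≤ pquot x j →
        ¬(j = 0 ∧ pquot x j = (a : ℤ)) →
        0 < medTheta x (pquot x j - a) j ∧ medTheta x (pquot x j - a) j < (a:ℝ) + 1) ∧
    ∀ᵐ x ∂(volume : Measure ℝ), x ∈ Set.Ioo (0:ℝ) 1 → Irrational x →
      {j : ℕ | (a : ℤ) ≤ pquot x j}.Infinite ∧
      ∀ z : ℝ, 0 ≤ z → z ≤ (a:ℝ) + 1 →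
        Tendsto (fun n : ℕ =>
            (((Finset.range n).filter fun k =>
                medTheta x (pquot x (Nat.nth (fun j => (a : ℤ) ≤ pquot x j) k) - a)
                  (Nat.nth (fun j => (a : ℤ) ≤ pquot x j) k) ≤ z).card : ℝ)
              / (n : ℝ))
          atTop (𝓝 (dist8 a z)) := by
  refine ⟨fun x hx hirr j hj hdeg => ⟨(medTheta_pos_and_lt hx hirr ha hj).1 hdeg,
    (medTheta_pos_and_lt hx hirr ha hj).2⟩, ?_⟩
  have hae : ∀ᵐ x ∂volume.restrict (Set.Ioo (0:ℝ) 1), ∀ p q : ℚ, p < q → Tendsto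
      (fun n : ℕ => birkhoffSum gaussNE (mediantObs a (ramp p q)) n (x, 0) / n) atTop
      (𝓝 ((∫ s in Set.Ioo (0:ℝ) 1, (∫ y in (0:ℝ)..a + s, ramp p q y) / (a + s) ^ 2) /
        Real.log 2)) := by
    simp only [ae_all_iff]
    intro p q hpq
    have hpq' : (p:ℝ) < q := by exact_mod_cast hpq
    rw [← setIntegral_mediantObs ha (abs_ramp_le_one p q) (abs_ramp_sub_le hpq')]
    exact ae_tendsto_birkhoffSum_div
      (branchLipschitz_mediantObs ha (abs_ramp_le_one p q) (abs_ramp_sub_le hpq'))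
  filter_upwards [(ae_restrict_iff' measurableSet_Ioo).1 hae] with x havg hx hirr
  have hlog := Real.log_pos one_lt_two
  have ha0 : (0:ℝ) < a := by exact_mod_cast ha
  have hmass : 0 < limitMass a (a + 1) := by
    rw [limitMass_natCast_add_one ha]
    refine Real.log_pos ?_
    rw [lt_div_iff₀ ha0]
    linarith
  have hP := tendsto_card_filter_medTheta hx hirr ha (havg hx) (z := a + 1) (by positivity)
  have hPiff : ∀ j, ((a : ℤ) ≤ pquot x j ∧ medTheta x (pquot x j - a) j ≤ a + 1) ↔
      (a : ℤ) ≤ pquot x j := fun j =>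
    ⟨fun h => h.1, fun h => ⟨h, (medTheta_pos_and_lt hx hirr ha h).2.le⟩⟩
  simp only [hPiff] at hP
  have key := fun z (hz : 0 ≤ z) => infinite_and_tendsto_card_filter_nth (div_pos hmass hlog) hP
    (tendsto_card_filter_medTheta hx hirr ha (havg hx) hz)
  refine ⟨(key 0 le_rfl).1, fun z hz hza => ?_⟩
  rw [dist8_eq ha hza, ← div_div_div_cancel_right₀ hlog.ne']
  exact (key z hz).2
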